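/- arXiv:2008.03893 — 10 statements merged into one kernel-verified Lean document; each statement's English description precedes it below -/
import Mathlib

section
/- Let H be an n×n Hermitian complex matrix and suppose H = P − Q where P and Q are positive semidefinite n×n complex matrices. Then Re(tr P) ≥ (‖H‖₁ + Re(tr H))/2 and Re(tr Q) ≥ (‖H‖₁ − Re(tr H))/2; in particular Re(tr P) + Re(tr Q) ≥ ‖H‖₁. Moreover, equality holds in these inequalities if and only if P·Q = 0, i.e. if and only if the ranges of P and Q are mutually orthogonal (in which case P and Q are the positive and negative parts of H given by its spectral decomposition). -/
open Matrix
open scoped ComplexOrder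

/-- Trace norm of a Hermitian complex matrix: the sum of the absolute values of
its eigenvalues. -/
noncomputable def traceNorm {n : Type*} [Fintype n] [DecidableEq n]
    (A : Matrix n n ℂ) (hA : A.IsHermitian) : ℝ :=
  ∑ i, |hA.eigenvalues i|

namespace Matrix

variable {n : Type*} [Fintype n]

/-- The real part of the quadratic form `v⋆ A v`. -/
noncomputable def reQuadForm (A : Matrix n n ℂ) (v : n → ℂ) : ℝ :=
  (star v ⬝ᵥ A *ᵥ v).re

theorem reQuadForm_sub (A B : Matrix n n ℂ) (v : n → ℂ) :
    reQuadForm (A - B) v = reQuadForm A v - reQuadForm B v := by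
  simp [reQuadForm, sub_mulVec, dotProduct_sub]

theorem PosSemidef.reQuadForm_nonneg {A : Matrix n n ℂ} (hA : A.PosSemidef) (v : n → ℂ) :
    0 ≤ reQuadForm A v :=
  (Complex.le_def.1 (hA.dotProduct_mulVec_nonneg v)).1

theorem PosSemidef.reQuadForm_eq_zero_iff {A : Matrix n n ℂ} (hA : A.PosSemidef) (v : n → ℂ) :
    reQuadForm A v = 0 ↔ A *ᵥ v = 0 := by
  rw [← hA.dotProduct_mulVec_zero_iff, reQuadForm]
  have h := (Complex.le_def.1 (hA.dotProduct_mulVec_nonneg v)).2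
  exact ⟨fun h0 => Complex.ext h0 h.symm, fun h0 => by rw [h0, Complex.zero_re]⟩

theorem PosSemidef.pos_of_mulVec_mulVec_eq_smul {A : Matrix n n ℂ} (hA : A.PosSemidef)
    {c : ℝ} {v : n → ℂ} (h : A *ᵥ (A *ᵥ v) = c • A *ᵥ v) (hv : A *ᵥ v ≠ 0) : 0 < c := by
  have hpos : 0 < (star v ⬝ᵥ A *ᵥ (A *ᵥ v)).re := by
    rw [dotProduct_mulVec, ← hA.isHermitian.eq, ← star_mulVec, hA.isHermitian.eq]
    exact (Complex.lt_def.1 (dotProduct_star_self_pos_iff.2 hv)).1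
  rw [h, dotProduct_smul, Complex.smul_re, smul_eq_mul] at hpos
  exact pos_of_mul_pos_left hpos (hA.reQuadForm_nonneg v)

/-- If `P Q = 0`, every eigenvector of `P - Q` is killed by `P` or by `Q`. -/
theorem PosSemidef.mulVec_eq_zero_or_of_mul_eq_zero {P Q : Matrix n n ℂ} (hP : P.PosSemidef)
    (hQ : Q.PosSemidef) (hPQ : P * Q = 0) {c : ℝ} {v : n → ℂ} (hv : (P - Q) *ᵥ v = c • v) :
    P *ᵥ v = 0 ∨ Q *ᵥ v = 0 := by
  have hQP : Q * P = 0 := by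
    simpa [hP.isHermitian.eq, hQ.isHermitian.eq] using (conjTranspose_eq_zero (M := P * Q)).2 hPQ
  by_contra! h
  have hc : 0 < c := hP.pos_of_mulVec_mulVec_eq_smul (v := v) (by
    have := congrArg (P *ᵥ ·) hv
    simpa [sub_mulVec, mulVec_sub, hPQ, mulVec_smul] using this) h.1
  have hc' : 0 < -c := hQ.pos_of_mulVec_mulVec_eq_smul (v := v) (by
    have := congrArg (fun w => -(Q *ᵥ w)) hv
    simpa [sub_mulVec, mulVec_sub, hQP, mulVec_smul] using this) h.2
  linarith

/-- An eigenvector of `P - Q` that is killed by `P` or by `Q` is killed by `P Q`. -/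
theorem mul_mulVec_eq_zero_of_eigenvector {P Q : Matrix n n ℂ} {c : ℝ} {v : n → ℂ}
    (hv : (P - Q) *ᵥ v = c • v) (h : P *ᵥ v = 0 ∨ Q *ᵥ v = 0) : (P * Q) *ᵥ v = 0 := by
  rw [← mulVec_mulVec]
  rcases h with h | h
  · have hQ : Q *ᵥ v = -(c • v) := by rw [← hv, sub_mulVec, h, zero_sub, neg_neg]
    rw [hQ, mulVec_neg, mulVec_smul, h, smul_zero, neg_zero]
  · rw [h, mulVec_zero]

theorem IsHermitian.mul_eq_zero_iff_orthogonal {P Q : Matrix n n ℂ} (hP : P.IsHermitian) :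
    P * Q = 0 ↔ ∀ x y : n → ℂ, star (P *ᵥ x) ⬝ᵥ (Q *ᵥ y) = 0 := by
  have key (x y : n → ℂ) : star (P *ᵥ x) ⬝ᵥ (Q *ᵥ y) = star x ⬝ᵥ (P * Q) *ᵥ y := by
    rw [star_mulVec, hP.eq, ← dotProduct_mulVec, mulVec_mulVec]
  simp_rw [key]
  refine ⟨fun h x y => by simp [h], fun h => ext_iff_mulVec.2 fun y => ?_⟩
  rw [zero_mulVec]
  exact dotProduct_star_self_eq_zero.1 (h _ y)

namespace IsHermitian

variable [DecidableEq n] {H : Matrix n n ℂ} (hH : H.IsHermitian)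

theorem trace_re_eq_sum_reQuadForm (A : Matrix n n ℂ) :
    A.trace.re = ∑ i, reQuadForm A ⇑(hH.eigenvectorBasis i) := by
  let U : Matrix n n ℂ := ↑(hH.eigenvectorUnitary)
  have hUU : U * star U = 1 := Unitary.coe_mul_star_self _
  have h : A.trace = (star U * (A * U)).trace := by
    rw [trace_mul_comm, Matrix.mul_assoc, hUU, Matrix.mul_one]
  rw [h, trace, Complex.re_sum]
  rfl

theorem reQuadForm_eigenvectorBasis (i : n) :
    reQuadForm H ⇑(hH.eigenvectorBasis i) = hH.eigenvalues i := by
  rw [hH.eigenvalues_eq i]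
  rfl

theorem eq_zero_of_mulVec_eigenvectorBasis {A : Matrix n n ℂ}
    (h : ∀ i, A *ᵥ ⇑(hH.eigenvectorBasis i) = 0) : A = 0 := by
  have hAU : A * (hH.eigenvectorUnitary : Matrix n n ℂ) = 0 := by
    ext j i
    exact congrFun (h i) j
  rw [← Matrix.mul_one A, ← Unitary.coe_mul_star_self hH.eigenvectorUnitary, ← Matrix.mul_assoc,
    hAU, Matrix.zero_mul]

end IsHermitian

end Matrix

section TraceNorm

variable {n : Type*} [Fintype n] [DecidableEq n] {H P Q : Matrix n n ℂ}

theorem abs_eigenvalues_le_reQuadForm_add (hH : H.IsHermitian) (hP : P.PosSemidef)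
    (hQ : Q.PosSemidef) (hHPQ : H = P - Q) (i : n) :
    |hH.eigenvalues i| ≤
      reQuadForm P ⇑(hH.eigenvectorBasis i) + reQuadForm Q ⇑(hH.eigenvectorBasis i) := by
  have hp := hP.reQuadForm_nonneg ⇑(hH.eigenvectorBasis i)
  have hq := hQ.reQuadForm_nonneg ⇑(hH.eigenvectorBasis i)
  have h : reQuadForm (P - Q) ⇑(hH.eigenvectorBasis i) = hH.eigenvalues i :=
    hHPQ ▸ hH.reQuadForm_eigenvectorBasis i
  rw [reQuadForm_sub] at h
  rw [abs_le]
  constructor <;> linarith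

theorem abs_eigenvalues_eq_reQuadForm_add_iff (hH : H.IsHermitian) (hP : P.PosSemidef)
    (hQ : Q.PosSemidef) (hHPQ : H = P - Q) (i : n) :
    |hH.eigenvalues i| =
        reQuadForm P ⇑(hH.eigenvectorBasis i) + reQuadForm Q ⇑(hH.eigenvectorBasis i) ↔
      P *ᵥ ⇑(hH.eigenvectorBasis i) = 0 ∨ Q *ᵥ ⇑(hH.eigenvectorBasis i) = 0 := by
  have hp := hP.reQuadForm_nonneg ⇑(hH.eigenvectorBasis i)
  have hq := hQ.reQuadForm_nonneg ⇑(hH.eigenvectorBasis i)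
  have h : reQuadForm (P - Q) ⇑(hH.eigenvectorBasis i) = hH.eigenvalues i :=
    hHPQ ▸ hH.reQuadForm_eigenvectorBasis i
  rw [reQuadForm_sub] at h
  rw [← hP.reQuadForm_eq_zero_iff, ← hQ.reQuadForm_eq_zero_iff, ← h]
  constructor
  · intro habs
    rcases abs_choice (reQuadForm P ⇑(hH.eigenvectorBasis i) -
      reQuadForm Q ⇑(hH.eigenvectorBasis i)) with h' | h'
    · right; linarith
    · left; linarith
  · rintro (h0 | h0)
    · simp [h0, abs_of_nonneg hq]
    · simp [h0, abs_of_nonneg hp]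

theorem traceNorm_le_trace_add_trace (hH : H.IsHermitian) (hP : P.PosSemidef)
    (hQ : Q.PosSemidef) (hHPQ : H = P - Q) :
    traceNorm H hH ≤ P.trace.re + Q.trace.re := by
  rw [hH.trace_re_eq_sum_reQuadForm P, hH.trace_re_eq_sum_reQuadForm Q, ← Finset.sum_add_distrib]
  exact Finset.sum_le_sum fun i _ => abs_eigenvalues_le_reQuadForm_add hH hP hQ hHPQ i

theorem traceNorm_eq_trace_add_trace_iff (hH : H.IsHermitian) (hP : P.PosSemidef)
    (hQ : Q.PosSemidef) (hHPQ : H = P - Q) :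
    traceNorm H hH = P.trace.re + Q.trace.re ↔ P * Q = 0 := by
  have heig (i : n) : (P - Q) *ᵥ ⇑(hH.eigenvectorBasis i) =
      hH.eigenvalues i • ⇑(hH.eigenvectorBasis i) := by
    rw [← hHPQ]
    exact hH.mulVec_eigenvectorBasis i
  rw [hH.trace_re_eq_sum_reQuadForm P, hH.trace_re_eq_sum_reQuadForm Q, ← Finset.sum_add_distrib,
    traceNorm, Finset.sum_eq_sum_iff_of_le fun i _ =>
      abs_eigenvalues_le_reQuadForm_add hH hP hQ hHPQ i]
  simp only [Finset.mem_univ, true_imp_iff, abs_eigenvalues_eq_reQuadForm_add_iff hH hP hQ hHPQ]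
  exact ⟨fun h => hH.eq_zero_of_mulVec_eigenvectorBasis fun i =>
      mul_mulVec_eq_zero_of_eigenvector (heig i) (h i),
    fun h i => hP.mulVec_eq_zero_or_of_mul_eq_zero hQ h (heig i)⟩

end TraceNorm

/-- If a Hermitian matrix `H` is written as a difference `P - Q` of two positive
semidefinite matrices, then `Re (tr P) ≥ (‖H‖₁ + Re (tr H))/2`,
`Re (tr Q) ≥ (‖H‖₁ - Re (tr H))/2`, hence `Re (tr P) + Re (tr Q) ≥ ‖H‖₁`; moreover
equality holds in these inequalities if and only if `P * Q = 0`, i.e. if and only if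
the ranges of `P` and `Q` are mutually orthogonal. -/
theorem posSemidef_decomposition_trace_bounds {n : ℕ}
    (H P Q : Matrix (Fin n) (Fin n) ℂ)
    (hH : H.IsHermitian) (hP : P.PosSemidef) (hQ : Q.PosSemidef)
    (hHPQ : H = P - Q) :
    ((P.trace).re ≥ (traceNorm H hH + (H.trace).re) / 2 ∧
     (Q.trace).re ≥ (traceNorm H hH - (H.trace).re) / 2 ∧
     (P.trace).re + (Q.trace).re ≥ traceNorm H hH) ∧
    (((P.trace).re = (traceNorm H hH + (H.trace).re) / 2 ∧
      (Q.trace).re = (traceNorm H hH - (H.trace).re) / 2 ∧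
      (P.trace).re + (Q.trace).re = traceNorm H hH) ↔ P * Q = 0) ∧
    (P * Q = 0 ↔ ∀ x y : Fin n → ℂ, star (P *ᵥ x) ⬝ᵥ (Q *ᵥ y) = 0) := by
  have htr : H.trace.re = P.trace.re - Q.trace.re := by
    rw [hHPQ, trace_sub, Complex.sub_re]
  have hle := traceNorm_le_trace_add_trace hH hP hQ hHPQ
  refine ⟨⟨by linarith, by linarith, hle⟩, ?_, hP.isHermitian.mul_eq_zero_iff_orthogonal⟩
  rw [← traceNorm_eq_trace_add_trace_iff hH hP hQ hHPQ]
  exact ⟨fun h => h.2.2.symm, fun h => ⟨by linarith, by linarith, h.symm⟩⟩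
end

section
/- Let A and B be nonempty finite types and let ψ : A×B → ℂ be a nonzero vector; let ρ be the rank-one matrix with entries ρ((a,b),(c,d)) = ψ(a,b)·conj(ψ(c,d)). Then the partial transpose ρ^Γ is positive semidefinite if and only if ψ is a product vector, i.e. there exist u : A → ℂ and v : B → ℂ with ψ(a,b) = u(a)·v(b) for all a, b. (A bipartite pure state is PPT if and only if it is separable, if and only if its Schmidt rank is 1.) -/
open Matrix
open scoped ComplexOrder

/-- Partial transpose over the first factor of a bipartite index:
`(M^Γ) (a,b) (c,d) = M (c,b) (a,d)`. -/
def ptrans {A B : Type*} (M : Matrix (A × B) (A × B) ℂ) : Matrix (A × B) (A × B) ℂ :=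
  Matrix.of fun p q => M (q.1, p.2) (p.1, q.2)

/-- If the partial transpose of `ψ ψᴴ` is positive semidefinite, then all `2 × 2` minors of the
coefficient matrix of `ψ` vanish. -/
lemma mul_eq_mul_of_posSemidef_ptrans {A B : Type*} (ψ : A × B → ℂ)
    (h : (ptrans (Matrix.of fun p q => ψ p * star (ψ q))).PosSemidef) (a c : A) (b d : B) :
    ψ (a, b) * ψ (c, d) = ψ (c, b) * ψ (a, d) := by
  have key := (h.submatrix ![(a, b), (a, d), (c, b), (c, d)]).dotProduct_mulVec_nonneg
    ![ψ (c, b), ψ (c, d), -ψ (a, b), -ψ (a, d)]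
  set z := ψ (a, b) * ψ (c, d) - ψ (c, b) * ψ (a, d) with hz
  have heq : star ![ψ (c, b), ψ (c, d), -ψ (a, b), -ψ (a, d)] ⬝ᵥ
      ((ptrans (Matrix.of fun p q => ψ p * star (ψ q))).submatrix
        ![(a, b), (a, d), (c, b), (c, d)] ![(a, b), (a, d), (c, b), (c, d)] *ᵥ
        ![ψ (c, b), ψ (c, d), -ψ (a, b), -ψ (a, d)]) = -(2 * (z * star z)) := by
    simp [hz, dotProduct, Matrix.mulVec, Fin.sum_univ_four, ptrans]
    ring
  rw [heq, Complex.star_def, Complex.mul_conj] at key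
  have hre : 0 ≤ -(2 * Complex.normSq z) := by exact_mod_cast key
  have hzero : Complex.normSq z = 0 := by linarith [Complex.normSq_nonneg z]
  exact sub_eq_zero.mp (Complex.normSq_eq_zero.mp hzero)

/-- A bipartite pure state is PPT if and only if it is separable: for a nonzero vector
`ψ : A × B → ℂ` and the rank-one matrix `ρ = ψ ψᴴ`, the partial transpose `ρ^Γ` is
positive semidefinite if and only if `ψ` is a product vector. -/
theorem pure_state_ppt_iff_product {A B : Type*}
    [Fintype A] [Fintype B] [Nonempty A] [Nonempty B]
    (ψ : A × B → ℂ) (hψ : ψ ≠ 0)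
    (ρ : Matrix (A × B) (A × B) ℂ)
    (hρ : ∀ p q, ρ p q = ψ p * star (ψ q)) :
    (ptrans ρ).PosSemidef ↔
      ∃ (u : A → ℂ) (v : B → ℂ), ∀ (a : A) (b : B), ψ (a, b) = u a * v b := by
  obtain rfl : ρ = Matrix.of fun p q => ψ p * star (ψ q) := by
    ext p q
    exact hρ p q
  constructor
  · intro h
    obtain ⟨⟨a₀, b₀⟩, h₀⟩ := Function.ne_iff.mp hψ
    rw [Pi.zero_apply] at h₀
    refine ⟨fun a => ψ (a, b₀), fun b => ψ (a₀, b) / ψ (a₀, b₀), fun a b => ?_⟩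
    rw [mul_div_assoc', eq_div_iff h₀, mul_comm]
    exact mul_eq_mul_of_posSemidef_ptrans ψ h a₀ a b₀ b
  · rintro ⟨u, v, huv⟩
    convert posSemidef_vecMulVec_self_star (fun p : A × B => star (u p.1) * v p.2) using 1
    ext ⟨a, b⟩ ⟨c, d⟩
    simp only [ptrans, Matrix.of_apply, vecMulVec_apply, Pi.star_apply, huv, star_mul', star_star]
    ring
end

section
/- Let A and B be nonempty finite types and let U be a unitary complex matrix indexed by A×B. Let C be the Choi matrix of the conjugation map ρ ↦ U·ρ·Uᴴ, i.e. C(((a,b),(a₂,b₂)),((c,d),(c₂,d₂))) = U((a₂,b₂),(a,b))·conj(U((c₂,d₂),(c,d))), and let C^Γ be its partial transpose in which both A-indices are transposed simultaneously: C^Γ(((a,b),(a₂,b₂)),((c,d),(c₂,d₂))) = C(((c,b),(c₂,b₂)),((a,d),(a₂,d₂))). Then C^Γ is positive semidefinite if and only if U is a Kronecker product, i.e. there exist a matrix V indexed by A and a matrix W indexed by B with U((a₂,b₂),(a,b)) = V(a₂,a)·W(b₂,b) for all indices. (A unitary operation is PPT if and only if it is separable, if and only if the Schmidt rank of U is 1.)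 -/
open Matrix
open scoped ComplexOrder

/-- If the partial transpose of the rank-one matrix `|M⟩⟨M|` is positive semidefinite, then all
`2 × 2` minors of `M` vanish. -/
theorem mul_eq_mul_of_posSemidef_partialTranspose {m n : Type*}
    (M : Matrix m n ℂ)
    (h : (Matrix.of fun x y : m × n => M y.1 x.2 * star (M x.1 y.2)).PosSemidef)
    (i k : m) (j l : n) : M i j * M k l = M i l * M k j := by
  have h4 := (h.submatrix ![(i, j), (i, l), (k, j), (k, l)]).dotProduct_mulVec_nonneg
    ![M k j, M k l, -M i j, -M i l]
  have key : star ![M k j, M k l, -M i j, -M i l] ⬝ᵥ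
      (((Matrix.of fun x y : m × n => M y.1 x.2 * star (M x.1 y.2)).submatrix
        ![(i, j), (i, l), (k, j), (k, l)] ![(i, j), (i, l), (k, j), (k, l)]) *ᵥ
          ![M k j, M k l, -M i j, -M i l]) =
      ((-2 * Complex.normSq (M i j * M k l - M i l * M k j) : ℝ) : ℂ) := by
    push_cast
    rw [← Complex.mul_conj]
    simp [dotProduct, mulVec, Fin.sum_univ_four]
    ring
  rw [key, Complex.zero_le_real] at h4
  have h0 := Complex.normSq_nonneg (M i j * M k l - M i l * M k j)
  exact sub_eq_zero.mp (Complex.normSq_eq_zero.mp (by linarith))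

/-- A matrix all of whose `2 × 2` minors vanish is an outer product. -/
theorem exists_eq_mul_of_minors_eq_zero {m n K : Type*} [Field K] (M : Matrix m n K)
    (h : ∀ i k j l, M i j * M k l = M i l * M k j) :
    ∃ (v : m → K) (w : n → K), ∀ i j, M i j = v i * w j := by
  by_cases hM : ∃ i j, M i j ≠ 0
  · obtain ⟨i₀, j₀, h₀⟩ := hM
    refine ⟨fun i => M i j₀, fun j => M i₀ j / M i₀ j₀, fun i j => ?_⟩
    field_simp
    exact h i i₀ j j₀
  · push Not at hM
    exact ⟨0, 0, fun i j => by simp [hM]⟩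

/-- A unitary operation `ρ ↦ U ρ Uᴴ` on a bipartite system is PPT (the partial transpose
of its Choi matrix, where both `A`-indices are transposed simultaneously, is positive
semidefinite) if and only if it is separable, i.e. if and only if `U` is a Kronecker
product `V ⊗ W` (Schmidt rank 1). -/
theorem unitary_ppt_iff_kronecker {A B : Type*}
    [Fintype A] [Fintype B] [DecidableEq A] [DecidableEq B] [Nonempty A] [Nonempty B]
    (U : Matrix (A × B) (A × B) ℂ) (hU : U ∈ Matrix.unitaryGroup (A × B) ℂ)
    (CΓ : Matrix ((A × B) × (A × B)) ((A × B) × (A × B)) ℂ)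
    (hCΓ : ∀ (a c : A) (b d : B) (a₂ c₂ : A) (b₂ d₂ : B),
      CΓ ((a, b), (a₂, b₂)) ((c, d), (c₂, d₂)) =
        U (c₂, b₂) (c, b) * star (U (a₂, d₂) (a, d))) :
    CΓ.PosSemidef ↔
      ∃ (V : Matrix A A ℂ) (W : Matrix B B ℂ),
        ∀ (a₂ a : A) (b₂ b : B), U (a₂, b₂) (a, b) = V a₂ a * W b₂ b := by
  constructor
  · intro h
    let M : Matrix (A × A) (B × B) ℂ := Matrix.of fun α β => U (α.1, β.1) (α.2, β.2)
    have hM : (Matrix.of fun x y : (A × A) × (B × B) =>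
        M y.1 x.2 * star (M x.1 y.2)).PosSemidef := by
      convert h.submatrix fun x : (A × A) × (B × B) =>
        ((x.1.2, x.2.2), (x.1.1, x.2.1)) using 1
      ext x y
      simp only [M, Matrix.of_apply, Matrix.submatrix_apply, hCΓ]
    obtain ⟨v, w, hvw⟩ := exists_eq_mul_of_minors_eq_zero M
      fun i k j l => mul_eq_mul_of_posSemidef_partialTranspose M hM i k j l
    exact ⟨fun a₂ a => v (a₂, a), fun b₂ b => w (b₂, b),
      fun a₂ a b₂ b => hvw (a₂, a) (b₂, b)⟩
  · rintro ⟨V, W, hVW⟩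
    convert Matrix.posSemidef_vecMulVec_self_star fun x : (A × B) × (A × B) =>
      star (V x.2.1 x.1.1) * W x.2.2 x.1.2 using 1
    ext ⟨⟨a, b⟩, a₂, b₂⟩ ⟨⟨c, d⟩, c₂, d₂⟩
    simp only [hCΓ, hVW, Matrix.vecMulVec_apply, Pi.star_apply, star_mul', star_star]
    ring
end

section
/- Let A and B be nonempty finite types with |A| = d_A and |B| = d_B, and let H be a Hermitian complex matrix indexed by A×B. Then ‖H‖₁ / min(d_A, d_B) ≤ ‖H^Γ‖₁ ≤ min(d_A, d_B) · ‖H‖₁, where H^Γ denotes the partial transpose of H (which is again Hermitian). In particular the trace norm X ↦ ‖X‖₁ and the norm X ↦ ‖X^Γ‖₁ are equivalent norms on Hermitian matrices indexed by A×B. -/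
open Matrix

open ComplexConjugate

/-- The quadratic form of the partial transpose of the rank-one matrix `v v*`, evaluated
at `w`. -/
noncomputable def ptransForm {A B : Type*} [Fintype A] [Fintype B] (v w : A × B → ℂ) : ℂ :=
  ∑ a, ∑ b, ∑ c, ∑ d, conj (w (a, b)) * v (c, b) * conj (v (a, d)) * w (c, d)

theorem norm_sum_mul_conj_swap_le {S : Type*} [Fintype S] (T : S → S → ℂ) :
    ‖∑ s, ∑ t, T s t * conj (T t s)‖ ≤ ∑ s, ∑ t, ‖T s t‖ ^ 2 := by
  calc ‖∑ s, ∑ t, T s t * conj (T t s)‖ ≤ ∑ s, ∑ t, ‖T s t * conj (T t s)‖ :=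
        (norm_sum_le _ _).trans (Finset.sum_le_sum fun _ _ => norm_sum_le _ _)
    _ ≤ ∑ s, ∑ t, (‖T s t‖ ^ 2 / 2 + ‖T t s‖ ^ 2 / 2) := by
        gcongr with s _ t _
        rw [norm_mul, RCLike.norm_conj]
        nlinarith [sq_nonneg (‖T s t‖ - ‖T t s‖)]
    _ = ∑ s, ∑ t, ‖T s t‖ ^ 2 := by
        simp only [Finset.sum_add_distrib]
        rw [Finset.sum_comm (f := fun s t => ‖T t s‖ ^ 2 / 2)]
        simp only [← Finset.sum_add_distrib, add_halves]

/-- If the family `w` satisfies Parseval's identity, then its values under the quadratic form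
of `(v v*)^Γ` sum in modulus to at most `d_A ‖v‖²`. -/
theorem sum_norm_ptransForm_le_left {A B J : Type*} [Fintype A] [Fintype B] [Fintype J]
    (v : A × B → ℂ) (w : J → A × B → ℂ)
    (hw : ∀ x : A × B → ℂ, ∑ j, ‖∑ p, conj (w j p) * x p‖ ^ 2 = ∑ p, ‖x p‖ ^ 2) :
    ∑ j, ‖ptransForm v (w j)‖ ≤ Fintype.card A * ∑ p, ‖v p‖ ^ 2 := by
  classical
  have hform : ∀ j, ptransForm v (w j) = ∑ a, ∑ c, (∑ b, conj (w j (a, b)) * v (c, b)) *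
      conj (∑ d, conj (w j (c, d)) * v (a, d)) := by
    intro j
    refine Finset.sum_congr rfl fun a _ => ?_
    rw [Finset.sum_comm]
    refine Finset.sum_congr rfl fun c _ => ?_
    rw [map_sum, Finset.sum_mul_sum]
    refine Finset.sum_congr rfl fun b _ => Finset.sum_congr rfl fun d _ => ?_
    simp only [map_mul, Complex.conj_conj]
    ring
  have hparseval : ∀ a c, ∑ j, ‖∑ b, conj (w j (a, b)) * v (c, b)‖ ^ 2 =
      ∑ b, ‖v (c, b)‖ ^ 2 := by
    intro a c
    have h := hw fun p => if p.1 = a then v (c, p.2) else 0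
    simp only [Fintype.sum_prod_type_right, mul_ite, mul_zero, apply_ite norm, norm_zero,
      ite_pow, ne_eq, OfNat.ofNat_ne_zero, not_false_eq_true, zero_pow,
      Finset.sum_ite_eq', Finset.mem_univ, if_true] at h
    exact h
  calc ∑ j, ‖ptransForm v (w j)‖
      ≤ ∑ j, ∑ a, ∑ c, ‖∑ b, conj (w j (a, b)) * v (c, b)‖ ^ 2 := by
        gcongr with j
        rw [hform]
        exact norm_sum_mul_conj_swap_le fun a c => ∑ b, conj (w j (a, b)) * v (c, b)
    _ = ∑ a, ∑ c, ∑ j, ‖∑ b, conj (w j (a, b)) * v (c, b)‖ ^ 2 := by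
        rw [Finset.sum_comm]
        exact Finset.sum_congr rfl fun a _ => Finset.sum_comm
    _ = Fintype.card A * ∑ p, ‖v p‖ ^ 2 := by
        simp [hparseval, Fintype.sum_prod_type]

theorem ptransForm_swap {A B : Type*} [Fintype A] [Fintype B] (v w : A × B → ℂ) :
    ptransForm (fun p => conj (v p.swap)) (fun p => w p.swap) = ptransForm v w := by
  unfold ptransForm
  rw [Finset.sum_comm]
  refine Finset.sum_congr rfl fun a _ => Finset.sum_congr rfl fun b _ => ?_
  rw [Finset.sum_comm]
  refine Finset.sum_congr rfl fun c _ => Finset.sum_congr rfl fun d _ => ?_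
  simp only [Prod.swap_prod_mk, Complex.conj_conj]
  ring

theorem sum_norm_ptransForm_le_right {A B J : Type*} [Fintype A] [Fintype B] [Fintype J]
    (v : A × B → ℂ) (w : J → A × B → ℂ)
    (hw : ∀ x : A × B → ℂ, ∑ j, ‖∑ p, conj (w j p) * x p‖ ^ 2 = ∑ p, ‖x p‖ ^ 2) :
    ∑ j, ‖ptransForm v (w j)‖ ≤ Fintype.card B * ∑ p, ‖v p‖ ^ 2 := by
  have hswap : ∀ {R : Type} [AddCommMonoid R] (f : A × B → R),
      ∑ p : B × A, f p.swap = ∑ p, f p := fun f => (Equiv.prodComm B A).sum_comp f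
  have h := sum_norm_ptransForm_le_left (fun p => conj (v p.swap)) (fun j p => w j p.swap) (by
    intro x
    rw [← (Equiv.prodComm A B).sum_comp fun p => ‖x p‖ ^ 2]
    refine Eq.trans ?_ (hw fun p => x p.swap)
    refine Finset.sum_congr rfl fun j _ => ?_
    rw [← hswap fun p => conj (w j p) * x p.swap]
    simp)
  simp only [ptransForm_swap, RCLike.norm_conj] at h
  rwa [hswap fun p => ‖v p‖ ^ 2] at h

theorem OrthonormalBasis.sum_norm_sq_sum_conj_mul {n J : Type*} [Fintype n] [Fintype J]
    (b : OrthonormalBasis J ℂ (EuclideanSpace ℂ n)) (x : n → ℂ) :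
    ∑ j, ‖∑ p, conj (b j p) * x p‖ ^ 2 = ∑ p, ‖x p‖ ^ 2 := by
  have h := b.sum_sq_norm_inner_right (WithLp.toLp 2 x)
  rw [EuclideanSpace.norm_sq_eq] at h
  simpa [PiLp.inner_apply, mul_comm] using h

theorem Matrix.IsHermitian.apply_eq_sum_eigenvalues {n : Type*} [Fintype n] [DecidableEq n]
    {H : Matrix n n ℂ} (hH : H.IsHermitian) (p q : n) :
    H p q = ∑ i, (hH.eigenvalues i : ℂ) *
      (hH.eigenvectorBasis i p * conj (hH.eigenvectorBasis i q)) := by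
  conv_lhs => rw [hH.spectral_theorem]
  rw [Unitary.conjStarAlgAut_apply, Matrix.mul_apply]
  refine Finset.sum_congr rfl fun i _ => ?_
  simp [Matrix.mul_diagonal, Matrix.star_apply]
  ring

theorem traceNorm_eq_sum_norm {n : Type*} [Fintype n] [DecidableEq n]
    {K : Matrix n n ℂ} (hK : K.IsHermitian) :
    traceNorm K hK = ∑ j, ‖∑ p, ∑ q, conj (hK.eigenvectorBasis j p) * K p q *
      hK.eigenvectorBasis j q‖ := by
  refine Finset.sum_congr rfl fun j _ => ?_
  have h : ∑ p, ∑ q, conj (hK.eigenvectorBasis j p) * K p q * hK.eigenvectorBasis j q =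
      star ⇑(hK.eigenvectorBasis j) ⬝ᵥ (K *ᵥ ⇑(hK.eigenvectorBasis j)) := by
    simp [dotProduct, mulVec, Finset.mul_sum, mul_assoc]
  rw [h, hK.mulVec_eigenvectorBasis, dotProduct_comm, smul_dotProduct,
    ← EuclideanSpace.inner_eq_star_dotProduct, inner_self_eq_norm_sq_to_K,
    hK.eigenvectorBasis.norm_eq_one]
  simp

theorem sum_ptrans_eq_sum_ptransForm {A B : Type*} [Fintype A] [Fintype B]
    [DecidableEq A] [DecidableEq B] {H : Matrix (A × B) (A × B) ℂ} (hH : H.IsHermitian)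
    (w : A × B → ℂ) :
    ∑ p, ∑ q, conj (w p) * ptrans H p q * w q =
      ∑ i, (hH.eigenvalues i : ℂ) * ptransForm (hH.eigenvectorBasis i) w := by
  have hform : ∀ i, ptransForm (hH.eigenvectorBasis i) w = ∑ p : A × B, ∑ q : A × B,
      conj (w p) * hH.eigenvectorBasis i (q.1, p.2) *
        conj (hH.eigenvectorBasis i (p.1, q.2)) * w q := by
    intro i
    simp only [ptransForm, Fintype.sum_prod_type]
  simp only [hform, Finset.mul_sum]
  conv_rhs => rw [Finset.sum_comm]
  refine Finset.sum_congr rfl fun p _ => ?_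
  conv_rhs => rw [Finset.sum_comm]
  refine Finset.sum_congr rfl fun q _ => ?_
  rw [ptrans, Matrix.of_apply, hH.apply_eq_sum_eigenvalues, Finset.mul_sum, Finset.sum_mul]
  refine Finset.sum_congr rfl fun i _ => ?_
  ring

theorem traceNorm_ptrans_le {A B : Type*} [Fintype A] [Fintype B]
    [DecidableEq A] [DecidableEq B] {H : Matrix (A × B) (A × B) ℂ} (hH : H.IsHermitian)
    (hHΓ : (ptrans H).IsHermitian) :
    traceNorm (ptrans H) hHΓ ≤
      (min (Fintype.card A) (Fintype.card B) : ℝ) * traceNorm H hH := by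
  have hbound : ∀ i, ∑ j, ‖ptransForm (hH.eigenvectorBasis i) (hHΓ.eigenvectorBasis j)‖ ≤
      (min (Fintype.card A) (Fintype.card B) : ℝ) := by
    intro i
    have hv : ∑ p, ‖hH.eigenvectorBasis i p‖ ^ 2 = 1 := by
      rw [← EuclideanSpace.norm_sq_eq, hH.eigenvectorBasis.norm_eq_one, one_pow]
    have hw := hHΓ.eigenvectorBasis.sum_norm_sq_sum_conj_mul
    have hl := sum_norm_ptransForm_le_left (hH.eigenvectorBasis i)
      (fun j => hHΓ.eigenvectorBasis j) hw
    have hr := sum_norm_ptransForm_le_right (hH.eigenvectorBasis i)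
      (fun j => hHΓ.eigenvectorBasis j) hw
    rw [hv, mul_one] at hl hr
    exact le_min hl hr
  rw [traceNorm_eq_sum_norm hHΓ]
  calc _ ≤ ∑ j, ∑ i, |hH.eigenvalues i| *
        ‖ptransForm (hH.eigenvectorBasis i) (hHΓ.eigenvectorBasis j)‖ := by
        gcongr with j
        rw [sum_ptrans_eq_sum_ptransForm hH]
        refine (norm_sum_le _ _).trans_eq (Finset.sum_congr rfl fun i _ => ?_)
        rw [norm_mul, Complex.norm_real, Real.norm_eq_abs]
    _ = ∑ i, |hH.eigenvalues i| *
        ∑ j, ‖ptransForm (hH.eigenvectorBasis i) (hHΓ.eigenvectorBasis j)‖ := by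
        rw [Finset.sum_comm]
        simp only [Finset.mul_sum]
    _ ≤ ∑ i, |hH.eigenvalues i| * (min (Fintype.card A) (Fintype.card B) : ℝ) := by
        gcongr with i
        exact hbound i
    _ = _ := by rw [← Finset.sum_mul, mul_comm, traceNorm]

theorem ptrans_isHermitian {A B : Type*} {H : Matrix (A × B) (A × B) ℂ}
    (hH : H.IsHermitian) : (ptrans H).IsHermitian :=
  Matrix.IsHermitian.ext fun _ _ => hH.apply _ _

/-- For a Hermitian matrix `H` on a bipartite system with local dimensions `d_A`, `d_B`,
the partial transpose `H^Γ` is again Hermitian and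
`‖H‖₁ / min d_A d_B ≤ ‖H^Γ‖₁ ≤ min d_A d_B · ‖H‖₁`; in particular the trace norm and
the trace norm after partial transposition are equivalent norms. -/
theorem traceNorm_ptrans_equiv {A B : Type*}
    [Fintype A] [Fintype B] [DecidableEq A] [DecidableEq B] [Nonempty A] [Nonempty B]
    (H : Matrix (A × B) (A × B) ℂ) (hH : H.IsHermitian) :
    (ptrans H).IsHermitian ∧
    ∀ hHΓ : (ptrans H).IsHermitian,
      traceNorm H hH / (min (Fintype.card A) (Fintype.card B) : ℝ)
          ≤ traceNorm (ptrans H) hHΓ ∧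
      traceNorm (ptrans H) hHΓ
          ≤ (min (Fintype.card A) (Fintype.card B) : ℝ) * traceNorm H hH := by
  refine ⟨ptrans_isHermitian hH, fun hHΓ => ⟨?_, traceNorm_ptrans_le hH hHΓ⟩⟩
  have hpos : (0 : ℝ) < min (Fintype.card A : ℝ) (Fintype.card B) :=
    lt_min (Nat.cast_pos.2 Fintype.card_pos) (Nat.cast_pos.2 Fintype.card_pos)
  rw [div_le_iff₀' hpos]
  exact traceNorm_ptrans_le hHΓ hH
end

section
/- Let A and B be nonempty finite types with |A| = d_A and |B| = d_B. For every density matrix ρ indexed by A×B (i.e., ρ positive semidefinite with tr ρ = 1), the trace norm of its partial transpose satisfies ‖ρ^Γ‖₁ ≤ min(d_A, d_B). Moreover this bound is attained: there exists a density matrix ρ (a maximally entangled pure state) with ‖ρ^Γ‖₁ = min(d_A, d_B). -/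
open Matrix
open scoped ComplexOrder

theorem re_trace_conjTranspose_mul_mul_le {n m : Type*} [Fintype n] [Fintype m] [DecidableEq n]
    {S : Matrix n n ℂ} (hS : Sᴴ * S = 1) (X Y : Matrix n m ℂ) :
    (Xᴴ * (S * Y)).trace.re ≤ ((Xᴴ * X).trace.re + (Yᴴ * Y).trace.re) / 2 := by
  have h := (Complex.le_def.1 (posSemidef_conjTranspose_mul_self (X - S * Y)).trace_nonneg).1
  have hY : (S * Y)ᴴ * (S * Y) = Yᴴ * Y := by
    rw [conjTranspose_mul, Matrix.mul_assoc, ← Matrix.mul_assoc Sᴴ, hS, Matrix.one_mul]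
  have hX : ((S * Y)ᴴ * X).trace.re = (Xᴴ * (S * Y)).trace.re := by
    rw [← conjTranspose_conjTranspose X, ← conjTranspose_mul, trace_conjTranspose,
      conjTranspose_conjTranspose]
    simp
  rw [conjTranspose_sub, Matrix.sub_mul, Matrix.mul_sub, Matrix.mul_sub, hY] at h
  simp only [trace_sub, Complex.sub_re, Complex.zero_re, hX] at h
  linarith

theorem re_trace_mul_ptrans_vecMulVec_le {A B : Type*} [Fintype A] [Fintype B] [DecidableEq A]
    [DecidableEq B] {S : Matrix (A × B) (A × B) ℂ} (hS : Sᴴ * S = 1) (v : A × B → ℂ) :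
    (S * ptrans (vecMulVec v (star v))).trace.re ≤
      Fintype.card A * (vecMulVec v (star v)).trace.re := by
  let X : Matrix (A × B) (A × A) ℂ := of fun p i => if p.1 = i.1 then v (i.2, p.2) else 0
  let Y : Matrix (A × B) (A × A) ℂ := of fun p i => if p.1 = i.2 then v (i.1, p.2) else 0
  have hXX : (Xᴴ * X).trace = Fintype.card A * (vecMulVec v (star v)).trace := by
    simp [X, trace, Matrix.mul_apply, Fintype.sum_prod_type, apply_ite, vecMulVec_apply, mul_comm]
  have hYY : (Yᴴ * Y).trace = Fintype.card A * (vecMulVec v (star v)).trace := by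
    simp [Y, trace, Matrix.mul_apply, Fintype.sum_prod_type, apply_ite, vecMulVec_apply, mul_comm]
    simp only [Finset.mul_sum]
  have hXSY : (Xᴴ * (S * Y)).trace = (S * ptrans (vecMulVec v (star v))).trace := by
    simp [X, Y, ptrans, trace, Matrix.mul_apply, Fintype.sum_prod_type, apply_ite,
      vecMulVec_apply, mul_comm]
    refine Finset.sum_congr rfl fun a _ => ?_
    rw [Finset.sum_comm]
    refine Finset.sum_congr rfl fun b _ => Finset.sum_congr rfl fun c _ => ?_
    rw [Finset.sum_mul]
    exact Finset.sum_congr rfl fun e _ => by ring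
  have h := re_trace_conjTranspose_mul_mul_le hS X Y
  rw [hXX, hYY, hXSY] at h
  simpa using h

theorem re_trace_mul_ptrans_le_card_left {A B : Type*} [Fintype A] [Fintype B] [DecidableEq A]
    [DecidableEq B] {S ρ : Matrix (A × B) (A × B) ℂ} (hS : Sᴴ * S = 1) (hρ : ρ.PosSemidef) :
    (S * ptrans ρ).trace.re ≤ Fintype.card A * ρ.trace.re := by
  obtain ⟨m, v, rfl⟩ := posSemidef_iff_eq_sum_vecMulVec.1 hρ
  have : ptrans (∑ i, vecMulVec (v i) (star (v i))) =
      ∑ i, ptrans (vecMulVec (v i) (star (v i))) := by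
    ext p q
    simp [ptrans, Matrix.sum_apply]
  rw [this, Matrix.mul_sum, trace_sum, trace_sum, Complex.re_sum, Complex.re_sum, Finset.mul_sum]
  exact Finset.sum_le_sum fun i _ => re_trace_mul_ptrans_vecMulVec_le hS (v i)

theorem re_trace_mul_ptrans_le_card_right {A B : Type*} [Fintype A] [Fintype B] [DecidableEq A]
    [DecidableEq B] {S ρ : Matrix (A × B) (A × B) ℂ} (hS : Sᴴ * S = 1) (hρ : ρ.PosSemidef) :
    (S * ptrans ρ).trace.re ≤ Fintype.card B * ρ.trace.re := by
  let e := Equiv.prodComm B A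
  have hS' : (Sᵀ.submatrix e e)ᴴ * Sᵀ.submatrix e e = 1 := by
    have : Sᵀᴴ = Sᴴᵀ := rfl
    rw [conjTranspose_submatrix, submatrix_mul_equiv, this, ← transpose_mul,
      mul_eq_one_comm.1 hS]
    simp
  have h := re_trace_mul_ptrans_le_card_left hS' (hρ.submatrix e)
  have h1 : ptrans (ρ.submatrix e e) = (ptrans ρ)ᵀ.submatrix e e := by
    ext p q
    simp [ptrans, e]
  have h2 (M : Matrix (A × B) (A × B) ℂ) : (M.submatrix e e).trace = M.trace :=
    e.sum_comp fun i => M i i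
  rwa [h1, submatrix_mul_equiv, h2, h2, ← transpose_mul, trace_transpose, trace_mul_comm] at h

theorem exists_isometry_diagonalizing {n : Type*} [Fintype n] [DecidableEq n]
    {X : Matrix n n ℂ} (hX : X.IsHermitian) :
    ∃ U : Matrix n n ℂ, Uᴴ * U = 1 ∧
      X = U * diagonal (fun i => (hX.eigenvalues i : ℂ)) * Uᴴ :=
  ⟨hX.eigenvectorUnitary, Unitary.coe_star_mul_self hX.eigenvectorUnitary, by
    have h := hX.spectral_theorem
    rwa [Unitary.conjStarAlgAut_apply] at h⟩

theorem exists_isometry_trace_eq_traceNorm {n : Type*} [Fintype n] [DecidableEq n]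
    {X : Matrix n n ℂ} (hX : X.IsHermitian) :
    ∃ S : Matrix n n ℂ, Sᴴ * S = 1 ∧ (S * X).trace.re = traceNorm X hX := by
  obtain ⟨U, hU, hsp⟩ := exists_isometry_diagonalizing hX
  let s : n → ℂ := fun i => if 0 ≤ hX.eigenvalues i then 1 else -1
  have hs : diagonal (star s) * diagonal s = 1 := by
    rw [diagonal_mul_diagonal, ← diagonal_one]
    congr 1
    ext i
    by_cases h : 0 ≤ hX.eigenvalues i <;> simp [s, h]
  refine ⟨U * diagonal s * Uᴴ, ?_, ?_⟩
  · calc (U * diagonal s * Uᴴ)ᴴ * (U * diagonal s * Uᴴ)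
        = U * (diagonal (star s) * (Uᴴ * U) * diagonal s) * Uᴴ := by
          simp [Matrix.mul_assoc]
      _ = 1 := by rw [hU, Matrix.mul_one, hs, Matrix.mul_one, mul_eq_one_comm.1 hU]
  · have : U * diagonal s * Uᴴ * X =
        U * (diagonal s * (Uᴴ * U) * diagonal (fun i => (hX.eigenvalues i : ℂ))) * Uᴴ := by
      conv_lhs => rw [hsp]
      simp only [Matrix.mul_assoc]
    rw [this, hU, Matrix.mul_one, Matrix.mul_assoc, trace_mul_comm, Matrix.mul_assoc, hU,
      Matrix.mul_one, diagonal_mul_diagonal, trace_diagonal, Complex.re_sum, traceNorm]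
    refine Finset.sum_congr rfl fun i _ => ?_
    by_cases h : 0 ≤ hX.eigenvalues i
    · simp [s, h, abs_of_nonneg h]
    · simp [s, h, abs_of_neg (not_le.1 h)]

/-- If the square of `d • X` is an orthogonal projection, the trace norm of `X` is
`d * tr (X ^ 2)`. -/
theorem traceNorm_eq_mul_trace_mul_self {n : Type*} [Fintype n] [DecidableEq n]
    {X : Matrix n n ℂ} (hX : X.IsHermitian) {d : ℝ} (hd : 0 < d)
    (h : ((d : ℂ) ^ 2) • (X * X * X) = X) :
    traceNorm X hX = d * (X * X).trace.re := by
  obtain ⟨U, hU, hsp⟩ := exists_isometry_diagonalizing hX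
  set D : Matrix n n ℂ := diagonal (fun i => (hX.eigenvalues i : ℂ)) with hD
  have hXU : X * U = U * D := by
    conv_lhs => rw [hsp, Matrix.mul_assoc, hU, Matrix.mul_one]
  have hev (i : n) : d ^ 2 * hX.eigenvalues i ^ 3 = hX.eigenvalues i := by
    have h3 : ((d : ℂ) ^ 2) • (D * D * D) = D := by
      have h4 : Uᴴ * (((d : ℂ) ^ 2) • (X * X * X)) * U = Uᴴ * X * U := by rw [h]
      simpa only [Matrix.mul_smul, Matrix.smul_mul, Matrix.mul_assoc, hXU, ← Matrix.mul_assoc X U,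
        ← Matrix.mul_assoc Uᴴ U, hU, Matrix.one_mul] using h4
    have h5 := congrFun (congrFun h3 i) i
    simp only [hD, diagonal_mul_diagonal, Matrix.smul_apply, diagonal_apply_eq, smul_eq_mul] at h5
    norm_cast at h5
    linarith
  have htr : (X * X).trace = ∑ i, (hX.eigenvalues i : ℂ) ^ 2 := by
    have : X * X = U * (D * D) * Uᴴ := by
      rw [← Matrix.mul_assoc, ← hXU, Matrix.mul_assoc X, Matrix.mul_assoc X, ← hsp]
    rw [this, Matrix.mul_assoc, trace_mul_comm, Matrix.mul_assoc, hU, Matrix.mul_one, hD,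
      diagonal_mul_diagonal, trace_diagonal]
    simp only [sq]
  rw [htr, Complex.re_sum, Finset.mul_sum, traceNorm]
  refine Finset.sum_congr rfl fun i _ => ?_
  have h1 := hev i
  generalize hX.eigenvalues i = x at h1
  have h2 : ((x : ℂ) ^ 2).re = x ^ 2 := by norm_cast
  rw [h2]
  rcases eq_or_ne x 0 with rfl | hx
  · simp
  have h3 : (d * |x|) ^ 2 = 1 := by
    rw [mul_pow, sq_abs]
    apply mul_right_cancel₀ hx
    linarith
  have h4 : d * |x| = 1 := by
    rwa [pow_eq_one_iff_of_nonneg (by positivity) two_ne_zero] at h3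
  rw [← sq_abs, sq, ← mul_assoc, h4, one_mul]

theorem exists_traceNorm_ptrans_eq {A B ι : Type*} [Fintype A] [Fintype B] [DecidableEq A]
    [DecidableEq B] [Fintype ι] [DecidableEq ι] [Nonempty ι] (f : ι ↪ A) (g : ι ↪ B) :
    ∃ ρ : Matrix (A × B) (A × B) ℂ, ρ.PosSemidef ∧ ρ.trace = 1 ∧
      ∃ hΓ : (ptrans ρ).IsHermitian, traceNorm (ptrans ρ) hΓ = Fintype.card ι := by
  let d : ℝ := Fintype.card ι
  have hd : 0 < d := by positivity
  have hdC : (d : ℂ) ≠ 0 := by exact_mod_cast hd.ne'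
  let E : Matrix (A × B) (ι × ι) ℂ := (1 : Matrix (A × B) (A × B) ℂ).submatrix id (Prod.map f g)
  let W : Matrix (ι × ι) (ι × ι) ℂ := (1 : Matrix (ι × ι) (ι × ι) ℂ).submatrix id Prod.swap
  let δ : ι × ι → ℂ := fun p => if p.1 = p.2 then 1 else 0
  let ψ : A × B → ℂ := E *ᵥ δ
  let ρ : Matrix (A × B) (A × B) ℂ := (d : ℂ)⁻¹ • vecMulVec ψ (star ψ)
  have hE : Eᴴ * E = 1 := by
    rw [conjTranspose_submatrix, conjTranspose_one,
      ← submatrix_mul _ _ _ _ _ Function.bijective_id, Matrix.mul_one]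
    exact submatrix_one _ (f.injective.prodMap g.injective)
  have hW : W * W = 1 := by
    ext p q
    simp [W, Matrix.mul_apply, Matrix.one_apply]
  have hWh : Wᴴ = W := by
    ext p q
    simp [W, Matrix.one_apply, Prod.ext_iff, and_comm, eq_comm]
  have hX : ptrans ρ = (d : ℂ)⁻¹ • (E * W * Eᴴ) := by
    ext p q
    have hEe (p : A × B) (i j : ι) :
        E p (i, j) = (if p.1 = f i then 1 else 0) * (if p.2 = g j then 1 else 0) := by
      simp [E, Matrix.one_apply, Prod.ext_iff, ← ite_and, and_comm]
    have hEW (i j : ι) : (E * W) p (i, j) = E p (j, i) := by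
      simp [W, Matrix.mul_apply, Matrix.one_apply]
    have hψ (p : A × B) : ψ p = ∑ i, E p (i, i) := by
      simp [ψ, δ, mulVec, dotProduct, Fintype.sum_prod_type]
    simp only [ptrans, ρ, of_apply, Matrix.smul_apply, vecMulVec_apply, Pi.star_apply, hψ,
      Matrix.mul_apply (M := E * W), Fintype.sum_prod_type, hEW, conjTranspose_apply, star_sum,
      Finset.sum_mul_sum, hEe]
    congr 1
    refine Finset.sum_congr rfl fun i _ => Finset.sum_congr rfl fun j _ => ?_
    simp only [star_mul', apply_ite star, star_one, star_zero]
    ring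
  have hherm : (ptrans ρ).IsHermitian := by
    rw [hX, IsHermitian, conjTranspose_smul, conjTranspose_mul, conjTranspose_mul,
      conjTranspose_conjTranspose, hWh, Matrix.mul_assoc]
    simp
  have hXX : ptrans ρ * ptrans ρ = ((d : ℂ)⁻¹ ^ 2) • (E * Eᴴ) := by
    rw [hX, Matrix.smul_mul, Matrix.mul_smul, smul_smul, sq]
    congr 1
    calc E * W * Eᴴ * (E * W * Eᴴ) = E * (W * (Eᴴ * E) * W) * Eᴴ := by
          simp only [Matrix.mul_assoc]
      _ = E * Eᴴ := by rw [hE, Matrix.mul_one, hW, Matrix.mul_one]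
  have htr : ρ.trace = 1 := by
    rw [trace_smul, trace_vecMulVec, dotProduct_comm, star_mulVec, dotProduct_mulVec,
      vecMul_vecMul, hE, vecMul_one]
    have : star δ ⬝ᵥ δ = (d : ℂ) := by
      simp [δ, d, dotProduct, Fintype.sum_prod_type]
    rw [this, smul_eq_mul, inv_mul_cancel₀ hdC]
  refine ⟨ρ, ?_, htr, hherm, ?_⟩
  · exact (posSemidef_vecMulVec_self_star ψ).smul (by positivity)
  · rw [traceNorm_eq_mul_trace_mul_self hherm hd, hXX, trace_smul, trace_mul_comm, hE, trace_one,
      Fintype.card_prod]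
    · have : (d : ℂ)⁻¹ ^ 2 • ((Fintype.card ι * Fintype.card ι : ℕ) : ℂ) = 1 := by
        rw [smul_eq_mul]
        push_cast
        change (d : ℂ)⁻¹ ^ 2 * (d * d) = 1
        field_simp
      rw [this]
      simp [d]
    · rw [hXX, hX, Matrix.smul_mul, Matrix.mul_smul, smul_smul, smul_smul,
        Matrix.mul_assoc E, Matrix.mul_assoc E W, ← Matrix.mul_assoc Eᴴ, hE, Matrix.one_mul]
      congr 1
      field_simp

/-- For any bipartite density matrix `ρ` (positive semidefinite, trace one) on
`A × B`, the trace norm of its partial transpose is at most `min d_A d_B`, and this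
bound is attained by some density matrix (a maximally entangled pure state). -/
theorem traceNorm_ptrans_le_min_card {A B : Type*}
    [Fintype A] [Fintype B] [DecidableEq A] [DecidableEq B] [Nonempty A] [Nonempty B] :
    (∀ ρ : Matrix (A × B) (A × B) ℂ, ρ.PosSemidef → ρ.trace = 1 →
      ∀ hΓ : (ptrans ρ).IsHermitian,
        traceNorm (ptrans ρ) hΓ ≤ (min (Fintype.card A) (Fintype.card B) : ℝ)) ∧
    (∃ ρ : Matrix (A × B) (A × B) ℂ, ρ.PosSemidef ∧ ρ.trace = 1 ∧
      ∃ hΓ : (ptrans ρ).IsHermitian,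
        traceNorm (ptrans ρ) hΓ = (min (Fintype.card A) (Fintype.card B) : ℝ)) := by
  refine ⟨fun ρ hρ hρ1 hΓ => ?_, ?_⟩
  · obtain ⟨S, hS, hSt⟩ := exists_isometry_trace_eq_traceNorm hΓ
    have hA := re_trace_mul_ptrans_le_card_left hS hρ
    have hB := re_trace_mul_ptrans_le_card_right hS hρ
    rw [hρ1, hSt, Complex.one_re, mul_one] at hA hB
    exact le_min hA hB
  · have : NeZero (min (Fintype.card A) (Fintype.card B)) :=
      ⟨(lt_min Fintype.card_pos Fintype.card_pos).ne'⟩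
    obtain ⟨f⟩ := Function.Embedding.nonempty_of_card_le
      (α := Fin (min (Fintype.card A) (Fintype.card B))) (β := A) (by simp)
    obtain ⟨g⟩ := Function.Embedding.nonempty_of_card_le
      (α := Fin (min (Fintype.card A) (Fintype.card B))) (β := B) (by simp)
    simpa using exists_traceNorm_ptrans_eq f g
end

section
/- Let A₁, B₁, A₂, B₂ be nonempty finite types and let V be a complex matrix from ℂ^(A₁×B₁) to ℂ^(A₂×B₂) admitting a Schmidt decomposition V = ∑_{i=1}^k λ_i (A_i ⊗ B_i), where λ_i > 0, the A_i are matrices from ℂ^{A₁} to ℂ^{A₂} satisfying tr(A_iᴴ A_j) = δ_{ij}, and the B_i are matrices from ℂ^{B₁} to ℂ^{B₂} satisfying tr(B_iᴴ B_j) = δ_{ij}. Let C be the Choi matrix of the map O ↦ V·O·Vᴴ and let C^Γ be its partial transpose in which both A-indices (input and output) are transposed simultaneously. Then C^Γ is Hermitian and ‖C^Γ‖₁ = (∑_{i=1}^k λ_i)². -/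
open Matrix
open scoped Kronecker

section TraceNorm

open scoped MatrixOrder ComplexOrder

variable {n m : Type*} [Fintype n] [DecidableEq n] [Fintype m] [DecidableEq m]

theorem trace_cfcAbs_eq_traceNorm (A : Matrix n n ℂ) (hA : A.IsHermitian) :
    (CFC.abs A).trace = (traceNorm A hA : ℂ) := by
  have h : IsSelfAdjoint A := hA
  rw [CFC.abs_eq_cfc_norm A, hA.cfc_eq, IsHermitian.cfc, Unitary.conjStarAlgAut_apply,
    trace_mul_comm, ← mul_assoc, Unitary.coe_star_mul_self, one_mul, trace_diagonal]
  simp [traceNorm]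

theorem traceNorm_eq_trace_of_posSemidef {A P : Matrix n n ℂ} (hA : A.IsHermitian)
    (hP : P.PosSemidef) (hPA : P * P = Aᴴ * A) : (traceNorm A hA : ℂ) = P.trace := by
  have hP0 : 0 ≤ P := nonneg_iff_posSemidef.2 hP
  rw [← trace_cfcAbs_eq_traceNorm, CFC.abs, star_eq_conjTranspose, CFC.sqrt_unique hPA hP0]

/-- The trace norm of a Hermitian matrix is the sum of its singular values, read off from
any singular value decomposition. -/
theorem traceNorm_of_svd {A : Matrix n n ℂ} (hA : A.IsHermitian) {U W : Matrix n m ℂ}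
    (hU : Uᴴ * U = 1) (hW : Wᴴ * W = 1) {d : m → ℝ} (hd : ∀ i, 0 ≤ d i)
    (h : A = U * diagonal (fun i => (d i : ℂ)) * Wᴴ) : traceNorm A hA = ∑ i, d i := by
  set D : Matrix m m ℂ := diagonal (fun i => (d i : ℂ))
  have hD : D.PosSemidef := PosSemidef.diagonal fun i => by simpa using hd i
  have hPA : (U * D * Uᴴ) * (U * D * Uᴴ) = Aᴴ * A := by
    calc (U * D * Uᴴ) * (U * D * Uᴴ) = U * D * (Uᴴ * U) * D * Uᴴ := by
          simp only [Matrix.mul_assoc]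
      _ = U * D * (Wᴴ * W) * Dᴴ * Uᴴ := by rw [hU, hW, hD.isHermitian.eq]
      _ = A * Aᴴ := by
          simp only [h, conjTranspose_mul, conjTranspose_conjTranspose, Matrix.mul_assoc]
      _ = Aᴴ * A := by rw [hA.eq]
  have key := traceNorm_eq_trace_of_posSemidef hA (hD.mul_mul_conjTranspose_same U) hPA
  rw [trace_mul_comm, ← Matrix.mul_assoc, hU, Matrix.one_mul, trace_diagonal] at key
  exact_mod_cast key

end TraceNorm

/-- The matrix whose column `(i, j)` is the vectorization of `conj (A j) ⊗ B i`. -/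
def vecConjKronecker {ι A₁ B₁ A₂ B₂ : Type*} (Amat : ι → Matrix A₂ A₁ ℂ)
    (Bmat : ι → Matrix B₂ B₁ ℂ) : Matrix ((A₁ × B₁) × (A₂ × B₂)) (ι × ι) ℂ :=
  of fun x p => star (Amat p.2 x.2.1 x.1.1) * Bmat p.1 x.2.2 x.1.2

theorem vecConjKronecker_conjTranspose_mul_self {ι A₁ B₁ A₂ B₂ : Type*} [DecidableEq ι]
    [Fintype A₁] [Fintype B₁] [Fintype A₂] [Fintype B₂]
    {Amat : ι → Matrix A₂ A₁ ℂ} {Bmat : ι → Matrix B₂ B₁ ℂ}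
    (hA : ∀ i j, ((Amat i)ᴴ * Amat j).trace = if i = j then 1 else 0)
    (hB : ∀ i j, ((Bmat i)ᴴ * Bmat j).trace = if i = j then 1 else 0) :
    (vecConjKronecker Amat Bmat)ᴴ * vecConjKronecker Amat Bmat = 1 := by
  ext ⟨i, j⟩ ⟨i', j'⟩
  have key : ((vecConjKronecker Amat Bmat)ᴴ * vecConjKronecker Amat Bmat) (i, j) (i', j') =
      ((Amat j')ᴴ * Amat j).trace * ((Bmat i)ᴴ * Bmat i').trace := by
    simp only [vecConjKronecker, mul_apply, trace, diag_apply, conjTranspose_apply, of_apply,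
      Fintype.sum_prod_type, star_mul', star_star]
    simp only [Finset.sum_mul_sum]
    refine Finset.sum_congr rfl fun a _ => Finset.sum_congr rfl fun b _ => ?_
    refine Finset.sum_congr rfl fun a₂ _ => Finset.sum_congr rfl fun b₂ _ => ?_
    ring
  rw [key, hA, hB, one_apply]
  by_cases h₁ : i = i' <;> by_cases h₂ : j = j' <;> simp [h₁, h₂, eq_comm]

/-- Let `V = ∑ i, λ i • (A i ⊗ B i)` be a Schmidt decomposition of a matrix between
bipartite systems (`λ i > 0`, `{A i}` and `{B i}` orthonormal families of matrices for
the Hilbert–Schmidt inner product), and let `CΓ` be the partial transpose, over both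
`A`-indices simultaneously, of the Choi matrix of `O ↦ V O Vᴴ`.  Then `CΓ` is
Hermitian and its trace norm equals `(∑ i, λ i)²`. -/
theorem traceNorm_choi_ptrans_of_schmidt {A₁ B₁ A₂ B₂ : Type*}
    [Fintype A₁] [Fintype B₁] [Fintype A₂] [Fintype B₂]
    [DecidableEq A₁] [DecidableEq B₁] [DecidableEq A₂] [DecidableEq B₂]
    (k : ℕ) (lam : Fin k → ℝ) (hlam : ∀ i, 0 < lam i)
    (Amat : Fin k → Matrix A₂ A₁ ℂ) (Bmat : Fin k → Matrix B₂ B₁ ℂ)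
    (hA : ∀ i j, ((Amat i)ᴴ * Amat j).trace = if i = j then 1 else 0)
    (hB : ∀ i j, ((Bmat i)ᴴ * Bmat j).trace = if i = j then 1 else 0)
    (V : Matrix (A₂ × B₂) (A₁ × B₁) ℂ)
    (hV : V = ∑ i, (lam i : ℂ) • (Amat i ⊗ₖ Bmat i))
    (CΓ : Matrix ((A₁ × B₁) × (A₂ × B₂)) ((A₁ × B₁) × (A₂ × B₂)) ℂ)
    (hCΓ : ∀ (a c : A₁) (b d : B₁) (a₂ c₂ : A₂) (b₂ d₂ : B₂),
      CΓ ((a, b), (a₂, b₂)) ((c, d), (c₂, d₂)) =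
        V (c₂, b₂) (c, b) * star (V (a₂, d₂) (a, d))) :
    CΓ.IsHermitian ∧
    ∀ hCΓherm : CΓ.IsHermitian, traceNorm CΓ hCΓherm = (∑ i, lam i) ^ 2 := by
  have hherm : CΓ.IsHermitian := by
    ext ⟨⟨a, b⟩, a₂, b₂⟩ ⟨⟨c, d⟩, c₂, d₂⟩
    simp only [conjTranspose_apply, hCΓ, star_mul', star_star]
    ring
  refine ⟨hherm, fun h => ?_⟩
  have hU := vecConjKronecker_conjTranspose_mul_self hA hB
  set U := vecConjKronecker Amat Bmat with hUdef
  have hW : (U.submatrix id Prod.swap)ᴴ * U.submatrix id Prod.swap = 1 := by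
    rw [conjTranspose_submatrix, ← submatrix_mul _ _ _ id _ Function.bijective_id, hU,
      submatrix_one _ Prod.swap_injective]
  have hsvd : CΓ = U * diagonal (fun p : Fin k × Fin k => ((lam p.1 * lam p.2 : ℝ) : ℂ)) *
      (U.submatrix id Prod.swap)ᴴ := by
    ext ⟨⟨a, b⟩, a₂, b₂⟩ ⟨⟨c, d⟩, c₂, d₂⟩
    rw [hCΓ, hV, mul_apply]
    simp only [mul_diagonal, hUdef, vecConjKronecker, of_apply, conjTranspose_apply,
      submatrix_apply, Fintype.sum_prod_type, Matrix.sum_apply, Matrix.smul_apply,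
      kroneckerMap_apply, star_sum, Finset.sum_mul_sum, id, Prod.fst_swap, Prod.snd_swap]
    refine Finset.sum_congr rfl fun i _ => Finset.sum_congr rfl fun j _ => ?_
    simp only [smul_eq_mul, star_mul', Complex.star_def, Complex.conj_ofReal,
      Complex.conj_conj, Complex.ofReal_mul]
    ring
  rw [traceNorm_of_svd h hU hW (fun p => (mul_pos (hlam p.1) (hlam p.2)).le) hsvd, sq,
    Finset.sum_mul_sum, Fintype.sum_prod_type]
end

section
/- Let N, n_s, n_d be natural numbers with 2 ≤ n_s ≤ N and n_d < n_s, and let ν_D > 0 and γ > 0 be real. Then the function r ↦ f(ν_D, γ, r) tends to the limit ν_D² · (N·n_s − n_s²)/(N·n_s − n_d²) both as r → 0⁺ and as r → ∞. -/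
open Filter

/-- The first-order behaviour at `0⁺` of `r ↦ (A r - √(B r)) / r`, where `A` is the quadratic
`a r² + b r + a g` and `B` is a quartic with `B 0 = (a g)²`. -/
lemma tendsto_sub_sqrt_div_nhdsGT_zero {a g : ℝ} (b k m : ℝ) (ha : 0 < a) (hg : 0 < g) :
    Tendsto (fun r : ℝ => ((a * r ^ 2 + b * r + a * g)
        - Real.sqrt (a ^ 2 * r ^ 4 - 2 * k * r ^ 3 + m * r ^ 2 - 2 * k * g * r + a ^ 2 * g ^ 2)) / r)
      (nhdsWithin 0 (Set.Ioi 0)) (nhds (b + k / a)) := by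
  have hB : HasDerivAt (fun r : ℝ =>
      a ^ 2 * r ^ 4 - 2 * k * r ^ 3 + m * r ^ 2 - 2 * k * g * r + a ^ 2 * g ^ 2)
      (-(2 * k * g)) 0 := by
    have h := (((((hasDerivAt_id (0 : ℝ)).pow 4).const_mul (a ^ 2)).sub
      (((hasDerivAt_id (0 : ℝ)).pow 3).const_mul (2 * k))).add
      (((hasDerivAt_id (0 : ℝ)).pow 2).const_mul m)).sub
      ((hasDerivAt_id (0 : ℝ)).const_mul (2 * k * g)) |>.add_const (a ^ 2 * g ^ 2)
    exact h.congr_deriv (by simp)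
  have hA : HasDerivAt (fun r : ℝ => a * r ^ 2 + b * r + a * g) b 0 := by
    have h := ((((hasDerivAt_id (0 : ℝ)).pow 2).const_mul a).add
      ((hasDerivAt_id (0 : ℝ)).const_mul b)).add_const (a * g)
    exact h.congr_deriv (by simp)
  have hag : 0 < a * g := mul_pos ha hg
  have hsqrt : Real.sqrt (a ^ 2 * g ^ 2) = a * g := by
    rw [← mul_pow, Real.sqrt_sq hag.le]
  have h := (hA.sub (hB.sqrt (by simp [ha.ne', hg.ne']))).tendsto_slope_zero_right
  have hlim : b - -(2 * k * g) / (2 * (a * g)) = b + k / a := by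
    field_simp
    ring
  simp only [zero_add, Pi.sub_apply, ne_eq, OfNat.ofNat_ne_zero, not_false_eq_true, zero_pow,
    mul_zero, sub_zero, hsqrt, sub_self, smul_eq_mul, hlim] at h
  exact h.congr fun r => by rw [inv_mul_eq_div]

/-- The squared smaller symplectic eigenvalue `f(ν_D, γ, r)` of the partially transposed
covariance matrix of two unitarily localized blocks (sizes summing to `n_s`, differing by
`n_d`) of a permutation-symmetric `N`-mode Gaussian state tends to
`ν_D² (N n_s - n_s²)/(N n_s - n_d²)` both as `r → 0⁺` and as `r → ∞`. -/
theorem f_tendsto_boundary (N ns nd : ℕ) (hns2 : 2 ≤ ns) (hnsN : ns ≤ N) (hnd : nd < ns)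
    (νD γ : ℝ) (hν : 0 < νD) (hγ : 0 < γ) :
    let Nr : ℝ := N
    let nsr : ℝ := ns
    let ndr : ℝ := nd
    let A : ℝ → ℝ := fun r =>
      (Nr * nsr - ndr ^ 2) * r ^ 2
        + (2 * Nr ^ 2 - 2 * Nr * nsr + ndr ^ 2 * (1 + γ ^ 2)) * r
        + (Nr * nsr - ndr ^ 2) * γ ^ 2
    let B : ℝ → ℝ := fun r =>
      (Nr * nsr - ndr ^ 2) ^ 2 * r ^ 4
        - 2 * ndr ^ 2 * (2 * Nr ^ 2 + ndr ^ 2 * (1 + γ ^ 2) - Nr * nsr * (3 + γ ^ 2)) * r ^ 3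
        + (Nr ^ 2 * (4 * ndr ^ 2 * (1 + γ ^ 2) - 2 * nsr ^ 2 * γ ^ 2)
            + ndr ^ 4 * (γ ^ 4 + 4 * γ ^ 2 + 1)
            - 4 * Nr * nsr * ndr ^ 2 * (1 + 2 * γ ^ 2)) * r ^ 2
        - 2 * ndr ^ 2 * (2 * Nr ^ 2 + ndr ^ 2 * (1 + γ ^ 2) - Nr * nsr * (3 + γ ^ 2))
            * γ ^ 2 * r
        + (Nr * nsr - ndr ^ 2) ^ 2 * γ ^ 4
    let f : ℝ → ℝ := fun r => (νD ^ 2 / (2 * Nr ^ 2 * r)) * (A r - Real.sqrt (B r))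
    Tendsto f (nhdsWithin 0 (Set.Ioi 0))
        (nhds (νD ^ 2 * (Nr * nsr - nsr ^ 2) / (Nr * nsr - ndr ^ 2))) ∧
    Tendsto f atTop
        (nhds (νD ^ 2 * (Nr * nsr - nsr ^ 2) / (Nr * nsr - ndr ^ 2))) := by
  intro Nr nsr ndr A B f
  have hns : (2 : ℝ) ≤ nsr := Nat.ofNat_le_cast.2 hns2
  have hN : nsr ≤ Nr := Nat.cast_le.2 hnsN
  have hd : ndr < nsr := Nat.cast_lt.2 hnd
  have hd0 : 0 ≤ ndr := Nat.cast_nonneg nd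
  have hNpos : 0 < Nr := by linarith
  have ha : 0 < Nr * nsr - ndr ^ 2 := by nlinarith
  have hzero : Tendsto f (nhdsWithin 0 (Set.Ioi 0))
      (nhds (νD ^ 2 * (Nr * nsr - nsr ^ 2) / (Nr * nsr - ndr ^ 2))) := by
    have h := (tendsto_sub_sqrt_div_nhdsGT_zero
      (2 * Nr ^ 2 - 2 * Nr * nsr + ndr ^ 2 * (1 + γ ^ 2))
      (ndr ^ 2 * (2 * Nr ^ 2 + ndr ^ 2 * (1 + γ ^ 2) - Nr * nsr * (3 + γ ^ 2)))
      (Nr ^ 2 * (4 * ndr ^ 2 * (1 + γ ^ 2) - 2 * nsr ^ 2 * γ ^ 2)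
            + ndr ^ 4 * (γ ^ 4 + 4 * γ ^ 2 + 1)
            - 4 * Nr * nsr * ndr ^ 2 * (1 + 2 * γ ^ 2))
      ha (pow_pos hγ 2)).const_mul (νD ^ 2 / (2 * Nr ^ 2))
    convert h using 1
    · funext r
      simp only [f, A, B]
      rw [← div_div, div_mul_eq_mul_div, mul_div_assoc]
      congr 4
      ring
    · congr 1
      field_simp
      ring
  refine ⟨hzero, ?_⟩
  have hinv : Tendsto (fun r : ℝ => γ ^ 2 / r) atTop (nhdsWithin 0 (Set.Ioi 0)) :=
    tendsto_nhdsWithin_iff.2 ⟨tendsto_id.const_div_atTop _, by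
      filter_upwards [eventually_gt_atTop 0] with r hr
      exact div_pos (pow_pos hγ 2) hr⟩
  refine (hzero.comp hinv).congr' ?_
  filter_upwards [eventually_gt_atTop 0] with r hr
  have hA : A (γ ^ 2 / r) = γ ^ 2 / r ^ 2 * A r := by
    simp only [A]
    field_simp
    ring
  have hB : B (γ ^ 2 / r) = (γ ^ 2 / r ^ 2) ^ 2 * B r := by
    simp only [B]
    field_simp
    ring
  have hsqrt : Real.sqrt (B (γ ^ 2 / r)) = γ ^ 2 / r ^ 2 * Real.sqrt (B r) := by
    rw [hB, Real.sqrt_mul (sq_nonneg _), Real.sqrt_sq (by positivity)]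
  simp only [Function.comp_apply, f]
  rw [hA, hsqrt]
  field_simp
end

section
/- Let ħ > 0 be real, let N, n_s, n_d be natural numbers with 2 ≤ n_s ≤ N and n_d < n_s, and let ν_D and γ be reals with ν_D ≥ ħ/2 and γ ≥ ħ/(2ν_D). Then (ν_D²/(2N²)) · ( 2N² + 2N·n_s·(γ−1) + n_d²·(γ−1)² − n_d·|γ−1|·√(4N² + 4N·n_s·(γ−1) + n_d²·(γ−1)²) ) ≥ ħ²/4. -/
/-- The value of the squared smaller symplectic eigenvalue of the partially transposed
covariance matrix of two blocks of a permutation-symmetric `N`-mode Gaussian state at its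
critical point `r = γ` is never below the entanglement threshold `hbar²/4`:
for valid states (`ν_D ≥ hbar/2`, `γ ≥ hbar/(2ν_D)`), the critical value satisfies
`f(ν_D, γ, γ) ≥ hbar²/4`. -/
theorem critical_value_ge_threshold (hbar : ℝ) (hhbar : 0 < hbar)
    (N ns nd : ℕ) (hns2 : 2 ≤ ns) (hnsN : ns ≤ N) (hnd : nd < ns)
    (νD γ : ℝ) (hν : hbar / 2 ≤ νD) (hγ : hbar / (2 * νD) ≤ γ) :
    hbar ^ 2 / 4 ≤
      (νD ^ 2 / (2 * (N : ℝ) ^ 2)) *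
        (2 * (N : ℝ) ^ 2 + 2 * (N : ℝ) * (ns : ℝ) * (γ - 1)
          + (nd : ℝ) ^ 2 * (γ - 1) ^ 2
          - (nd : ℝ) * |γ - 1| *
            Real.sqrt (4 * (N : ℝ) ^ 2 + 4 * (N : ℝ) * (ns : ℝ) * (γ - 1)
              + (nd : ℝ) ^ 2 * (γ - 1) ^ 2)) := by
  have hν0 : 0 < νD := by linarith
  have hνγ : hbar / 2 ≤ νD * γ := by
    rw [div_le_iff₀ (by positivity)] at hγ
    linarith
  have hγ0 : 0 < γ := lt_of_lt_of_le (by positivity) hγ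
  have hN : (0 : ℝ) < N := by
    have : 0 < N := by omega
    exact_mod_cast this
  have hsN : (ns : ℝ) ≤ N := by exact_mod_cast hnsN
  have hds : (nd : ℝ) ≤ ns := by exact_mod_cast hnd.le
  have hd : (0 : ℝ) ≤ nd := Nat.cast_nonneg nd
  generalize (N : ℝ) = n at *
  generalize (ns : ℝ) = s at *
  generalize (nd : ℝ) = d at *
  set A := 4 * n ^ 2 + 4 * n * s * (γ - 1) + d ^ 2 * (γ - 1) ^ 2 with hA
  -- The bracket is a perfect square, so it suffices to bound its root from below.
  have key : ∃ m : ℝ, hbar / 2 ≤ νD * m ∧ 0 ≤ m ∧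
      (d * |γ - 1| + 2 * n * m) ^ 2 ≤ A := by
    rcases le_total 1 γ with h | h
    · refine ⟨1, by linarith, zero_le_one, ?_⟩
      rw [abs_of_nonneg (by linarith)]
      have h1 := mul_nonneg (mul_nonneg hN.le (sub_nonneg.2 hds)) (sub_nonneg.2 h)
      linear_combination 4 * h1
    · refine ⟨γ, hνγ, hγ0.le, ?_⟩
      rw [abs_of_nonpos (by linarith)]
      have h1 : 0 ≤ n * (1 - γ) * (n - s) :=
        mul_nonneg (mul_nonneg hN.le (sub_nonneg.2 h)) (sub_nonneg.2 hsN)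
      have h2 : 0 ≤ n * (1 - γ) * (γ * (n - d)) :=
        mul_nonneg (mul_nonneg hN.le (sub_nonneg.2 h))
          (mul_nonneg hγ0.le (by linarith))
      linear_combination 4 * h1 + 4 * h2
  obtain ⟨m, hm, hm0, hmA⟩ := key
  have hA0 : 0 ≤ A := (sq_nonneg _).trans hmA
  have hR : d * |γ - 1| + 2 * n * m ≤ √A := Real.le_sqrt_of_sq_le hmA
  have hsq : √A ^ 2 = A := Real.sq_sqrt hA0
  have hroot : m ≤ (√A - d * |γ - 1|) / (2 * n) := by
    rw [le_div_iff₀ (by positivity)]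
    linarith
  calc hbar ^ 2 / 4 = (hbar / 2) ^ 2 := by ring
    _ ≤ (νD * ((√A - d * |γ - 1|) / (2 * n))) ^ 2 := by
      gcongr
      exact hm.trans (by gcongr)
    _ = _ := by
      field_simp
      linear_combination hsq + d ^ 2 * sq_abs (γ - 1) + hA
end

section
/- Let ħ > 0 be real and let N, n_s, n_d be natural numbers with 2 ≤ n_s < N and n_d < n_s. Consider the set S of real numbers of the form (1/2)·ln( max( ħ²/(4·f(ν_D,γ,r)), 1 ) ) as (ν_D, γ, r) ranges over all reals with ν_D ≥ ħ/2, ν_D·γ ≥ ħ/2 and r > 0. Then (1/2)·ln( 1 + (n_s² − n_d²)/(n_s·(N − n_s)) ) is the least upper bound of S, and this supremum is not attained by any element of S. -/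
namespace SymmetricGaussian

/-- The polynomial `A(r)`. -/
def traceTerm (N s d γ r : ℝ) : ℝ :=
  (N * s - d ^ 2) * r ^ 2
    + (2 * N ^ 2 - 2 * N * s + d ^ 2 * (1 + γ ^ 2)) * r
    + (N * s - d ^ 2) * γ ^ 2

/-- The discriminant `B(r)`. -/
def discr (N s d γ r : ℝ) : ℝ :=
  (N * s - d ^ 2) ^ 2 * r ^ 4
    - 2 * d ^ 2 * (2 * N ^ 2 + d ^ 2 * (1 + γ ^ 2)
        - N * s * (3 + γ ^ 2)) * r ^ 3
    + (N ^ 2 * (4 * d ^ 2 * (1 + γ ^ 2) - 2 * s ^ 2 * γ ^ 2)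
        + d ^ 4 * (γ ^ 4 + 4 * γ ^ 2 + 1)
        - 4 * N * s * d ^ 2 * (1 + 2 * γ ^ 2)) * r ^ 2
    - 2 * d ^ 2 * (2 * N ^ 2 + d ^ 2 * (1 + γ ^ 2)
        - N * s * (3 + γ ^ 2)) * γ ^ 2 * r
    + (N * s - d ^ 2) ^ 2 * γ ^ 4

/-- The square of the smaller partially transposed symplectic eigenvalue. -/
noncomputable def eigSq (N s d ν γ r : ℝ) : ℝ :=
  (ν ^ 2 / (2 * N ^ 2 * r)) * (traceTerm N s d γ r - Real.sqrt (discr N s d γ r))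

/-- The infimum of `eigSq` in units of `ħ² / 4`. -/
noncomputable def eigInf (N s d : ℝ) : ℝ := s * (N - s) / (N * s - d ^ 2)

lemma traceTerm_sq_sub_discr (N s d γ r : ℝ) :
    traceTerm N s d γ r ^ 2 - discr N s d γ r =
      4 * N ^ 2 * r * ((s * r + (N - s)) * ((N - s) * r + s * γ ^ 2)) := by
  unfold traceTerm discr
  ring

section

variable {N s d : ℝ}

lemma gap_pos (hd : 0 ≤ d) (hds : d < s) (hsN : s < N) : 0 < N * s - d ^ 2 := by
  nlinarith

lemma eigInf_pos (hd : 0 ≤ d) (hds : d < s) (hsN : s < N) : 0 < eigInf N s d :=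
  div_pos (mul_pos (by linarith) (by linarith)) (gap_pos hd hds hsN)

lemma gap_mul_eigInf (hd : 0 ≤ d) (hds : d < s) (hsN : s < N) :
    (N * s - d ^ 2) * eigInf N s d = s * (N - s) :=
  mul_div_cancel₀ _ (gap_pos hd hds hsN).ne'

lemma eigInf_lt_one (hd : 0 ≤ d) (hds : d < s) (hsN : s < N) : eigInf N s d < 1 := by
  rw [eigInf, div_lt_one (gap_pos hd hds hsN)]
  nlinarith

lemma one_add_div_eq_inv_eigInf (hd : 0 ≤ d) (hds : d < s) (hsN : s < N) :
    1 + (s ^ 2 - d ^ 2) / (s * (N - s)) = (eigInf N s d)⁻¹ := by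
  have h : s * (N - s) ≠ 0 := (mul_pos (by linarith) (by linarith)).ne'
  rw [eigInf, inv_div, eq_div_iff h, add_mul, div_mul_cancel₀ _ h]
  ring

/-- `s² - d² c` is small compared with `N² (1 - c²)`, for `c = eigInf N s d`. -/
lemma sq_sub_lt (hd : 0 ≤ d) (hds : d < s) (hsN : s < N) :
    s ^ 2 - d ^ 2 * eigInf N s d < N ^ 2 * (1 - eigInf N s d ^ 2) := by
  have hc := gap_mul_eigInf hd hds hsN
  have hc0 := eigInf_pos hd hds hsN
  have hc1 := eigInf_lt_one hd hds hsN
  set c := eigInf N s d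
  have h : s ^ 2 - d ^ 2 * c = s * N * (1 - c) := by linear_combination hc
  have hN : 0 < N := by linarith
  have h1 : s * N < N ^ 2 * (1 + c) := by nlinarith [mul_pos (pow_pos hN 2) hc0]
  rw [h]
  nlinarith [mul_lt_mul_of_pos_right h1 (sub_pos.2 hc1)]

lemma dsq_mul_eigInf_lt (hd : 0 ≤ d) (hds : d < s) (hsN : s < N) :
    d ^ 2 * eigInf N s d < s ^ 2 := by
  have hc0 := eigInf_pos hd hds hsN
  have hc1 := eigInf_lt_one hd hds hsN
  have h : d ^ 2 ≤ s ^ 2 := pow_le_pow_left₀ hd hds.le 2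
  nlinarith [pow_pos (hd.trans_lt hds) 2, sq_nonneg d]

lemma charPoly_pos_of_one_le (hd : 0 ≤ d) (hds : d < s) (hsN : s < N) {γ r : ℝ}
    (hγ : 1 ≤ γ) (hr : 0 < r) :
    0 < (s * r + (N - s)) * ((N - s) * r + s * γ ^ 2)
      - traceTerm N s d γ r * eigInf N s d + N ^ 2 * r * eigInf N s d ^ 2 := by
  have hc := gap_mul_eigInf hd hds hsN
  have hc1 := eigInf_lt_one hd hds hsN
  have hds' := dsq_mul_eigInf_lt hd hds hsN
  set c := eigInf N s d
  have key : (s * r + (N - s)) * ((N - s) * r + s * γ ^ 2)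
      - traceTerm N s d γ r * c + N ^ 2 * r * c ^ 2
      = r * ((s ^ 2 - d ^ 2 * c) * (γ ^ 2 - 1) + N ^ 2 * (1 - c) ^ 2) := by
    unfold traceTerm
    linear_combination (-(r ^ 2) - γ ^ 2 + 2 * r) * hc
  rw [key]
  have hN : 0 < N := by linarith
  have h1 : 0 ≤ (s ^ 2 - d ^ 2 * c) * (γ ^ 2 - 1) :=
    mul_nonneg (by linarith) (by nlinarith)
  have h2 : 0 < N ^ 2 * (1 - c) ^ 2 := mul_pos (pow_pos hN 2) (pow_pos (by linarith) 2)
  exact mul_pos hr (by linarith)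

lemma charPoly_pos_of_le_one (hd : 0 ≤ d) (hds : d < s) (hsN : s < N) {γ r : ℝ}
    (hγ0 : 0 < γ) (hγ : γ ≤ 1) (hr : 0 < r) :
    0 < (s * r + (N - s)) * ((N - s) * r + s * γ ^ 2)
      - traceTerm N s d γ r * (eigInf N s d * γ ^ 2)
      + N ^ 2 * r * (eigInf N s d * γ ^ 2) ^ 2 := by
  have hc := gap_mul_eigInf hd hds hsN
  have hc1 := eigInf_lt_one hd hds hsN
  have hsq := sq_sub_lt hd hds hsN
  set c := eigInf N s d
  have key : (s * r + (N - s)) * ((N - s) * r + s * γ ^ 2)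
      - traceTerm N s d γ r * (c * γ ^ 2) + N ^ 2 * r * (c * γ ^ 2) ^ 2
      = (1 - γ ^ 2) * (s * (N - s) * (r - γ) ^ 2 + r * ((N - s) ^ 2 * (1 - γ ^ 2)
          + 2 * s * (N - s) * (γ * (1 - γ))
          + γ ^ 2 * (N ^ 2 * (1 - c ^ 2) - (s ^ 2 - d ^ 2 * c))))
        + r * (N ^ 2 * γ ^ 2 * (1 - c) ^ 2) := by
    unfold traceTerm
    linear_combination (-(r ^ 2) - γ ^ 2 + 2 * r) * γ ^ 2 * hc
  rw [key]
  have hs : 0 < s := by linarith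
  have hN : 0 < N := by linarith
  have ht : 0 < N - s := by linarith
  have hG : 0 ≤ 1 - γ ^ 2 := by nlinarith
  have hg : 0 ≤ 1 - γ := by linarith
  have hq : 0 ≤ N ^ 2 * (1 - c ^ 2) - (s ^ 2 - d ^ 2 * c) := by linarith
  have h1c : 0 < 1 - c := by linarith
  positivity

lemma lt_traceTerm_of_one_le (hd : 0 ≤ d) (hds : d < s) (hsN : s < N) {γ r : ℝ}
    (hγ : 1 ≤ γ) (hr : 0 < r) :
    2 * N ^ 2 * r * eigInf N s d < traceTerm N s d γ r := by
  have hc1 := eigInf_lt_one hd hds hsN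
  have ha := gap_pos hd hds hsN
  have hN : 0 < N := by linarith
  have h1 : 2 * N ^ 2 * r * eigInf N s d < 2 * N ^ 2 * r * 1 :=
    mul_lt_mul_of_pos_left hc1 (by positivity)
  have hg : 0 ≤ γ ^ 2 - 1 := by nlinarith
  have h2 : traceTerm N s d γ r - 2 * N ^ 2 * r * 1
      = (N * s - d ^ 2) * ((r - 1) ^ 2 + (γ ^ 2 - 1)) + d ^ 2 * (γ ^ 2 - 1) * r := by
    unfold traceTerm
    ring
  have h3 : 0 ≤ traceTerm N s d γ r - 2 * N ^ 2 * r * 1 := by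
    rw [h2]
    positivity
  linarith

lemma lt_traceTerm_of_le_one (hd : 0 ≤ d) (hds : d < s) (hsN : s < N) {γ r : ℝ}
    (hγ0 : 0 < γ) (hγ : γ ≤ 1) (hr : 0 < r) :
    2 * N ^ 2 * r * (eigInf N s d * γ ^ 2) < traceTerm N s d γ r := by
  have hc1 := eigInf_lt_one hd hds hsN
  have ha := gap_pos hd hds hsN
  have hN : 0 < N := by linarith
  have ht : 0 < N - s := by linarith
  have h1 : 2 * N ^ 2 * r * (eigInf N s d * γ ^ 2) < 2 * N ^ 2 * r * (1 * γ ^ 2) := by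
    gcongr
  have hg : 0 ≤ 1 - γ := by linarith
  have hg2 : 0 ≤ 1 - γ ^ 2 := by nlinarith
  have h2 : traceTerm N s d γ r - 2 * N ^ 2 * r * (1 * γ ^ 2)
      = (N * s - d ^ 2) * ((r - γ) ^ 2 + 2 * r * (γ * (1 - γ)))
        + r * (2 * N * (N - s) * (1 - γ ^ 2) + d ^ 2 * (1 - γ ^ 2)) := by
    unfold traceTerm
    ring
  have h3 : 0 ≤ traceTerm N s d γ r - 2 * N ^ 2 * r * (1 * γ ^ 2) := by
    rw [h2]
    positivity
  linarith

lemma lt_eigSq_of_charPoly_pos {ν γ r l : ℝ} (hN : 0 < N) (hν : 0 < ν) (hr : 0 < r)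
    (hA : 2 * N ^ 2 * r * l < traceTerm N s d γ r)
    (hQ : 0 < (s * r + (N - s)) * ((N - s) * r + s * γ ^ 2)
      - traceTerm N s d γ r * l + N ^ 2 * r * l ^ 2) :
    ν ^ 2 * l < eigSq N s d ν γ r := by
  have hid := traceTerm_sq_sub_discr N s d γ r
  have hroot : Real.sqrt (discr N s d γ r) < traceTerm N s d γ r - 2 * N ^ 2 * r * l := by
    rw [Real.sqrt_lt' (by linarith)]
    have h := mul_pos (by positivity : 0 < 4 * N ^ 2 * r) hQ
    linear_combination h - hid
  have hK : 0 < 2 * N ^ 2 * r := by positivity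
  calc ν ^ 2 * l = ν ^ 2 / (2 * N ^ 2 * r) * (2 * N ^ 2 * r * l) := by field_simp
    _ < eigSq N s d ν γ r := mul_lt_mul_of_pos_left (by linarith) (by positivity)

lemma lt_eigSq (hd : 0 ≤ d) (hds : d < s) (hsN : s < N) {h ν γ r : ℝ} (hh : 0 < h)
    (hν : h ≤ ν) (hνγ : h ≤ ν * γ) (hr : 0 < r) :
    h ^ 2 * eigInf N s d < eigSq N s d ν γ r := by
  have hν0 : 0 < ν := hh.trans_le hν
  have hγ0 : 0 < γ := pos_of_mul_pos_right (hh.trans_le hνγ) hν0.le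
  have hN : 0 < N := by linarith
  have hc0 := eigInf_pos hd hds hsN
  rcases le_total 1 γ with hγ | hγ
  · refine lt_of_le_of_lt ?_ (lt_eigSq_of_charPoly_pos hN hν0 hr
      (lt_traceTerm_of_one_le hd hds hsN hγ hr) (charPoly_pos_of_one_le hd hds hsN hγ hr))
    gcongr
  · refine lt_of_le_of_lt ?_ (lt_eigSq_of_charPoly_pos hN hν0 hr
      (lt_traceTerm_of_le_one hd hds hsN hγ0 hγ hr)
      (charPoly_pos_of_le_one hd hds hsN hγ0 hγ hr))
    calc h ^ 2 * eigInf N s d ≤ (ν * γ) ^ 2 * eigInf N s d := by gcongr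
      _ = ν ^ 2 * (eigInf N s d * γ ^ 2) := by ring

lemma logNegativity_lt (hd : 0 ≤ d) (hds : d < s) (hsN : s < N) {hbar ν γ r : ℝ}
    (hh : 0 < hbar) (hν : hbar / 2 ≤ ν) (hνγ : hbar / 2 ≤ ν * γ) (hr : 0 < r) :
    (1 / 2) * Real.log (max (hbar ^ 2 / (4 * eigSq N s d ν γ r)) 1)
      < (1 / 2) * Real.log (1 + (s ^ 2 - d ^ 2) / (s * (N - s))) := by
  have hlt := lt_eigSq hd hds hsN (half_pos hh) hν hνγ hr
  have hc0 := eigInf_pos hd hds hsN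
  have hc1 := eigInf_lt_one hd hds hsN
  have hf : 0 < eigSq N s d ν γ r := lt_trans (by positivity) hlt
  rw [one_add_div_eq_inv_eigInf hd hds hsN]
  refine mul_lt_mul_of_pos_left (Real.log_lt_log (by positivity) (max_lt ?_ ?_)) (by norm_num)
  · rw [div_lt_iff₀ (by positivity), inv_mul_eq_div, lt_div_iff₀ hc0]
    linarith
  · exact (one_lt_inv₀ hc0).2 hc1

open Filter Topology in
lemma tendsto_inv_eigSq (hd : 0 ≤ d) (hds : d < s) (hsN : s < N) {hbar : ℝ}
    (hh : 0 < hbar) :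
    Tendsto (fun u => hbar ^ 2 / (4 * eigSq N s d (hbar / 2) 1 u⁻¹)) (𝓝[>] 0)
      (𝓝 (eigInf N s d)⁻¹) := by
  have ha := gap_pos hd hds hsN
  have hs : 0 < s := by linarith
  have ht : 0 < N - s := by linarith
  have hN : 0 < N := by linarith
  let D' : ℝ → ℝ := fun u =>
    (N * s - d ^ 2) ^ 2 * (1 + u ^ 4)
      - 2 * d ^ 2 * (2 * N ^ 2 + d ^ 2 * 2 - N * s * 4) * (u + u ^ 3)
      + (N ^ 2 * (4 * d ^ 2 * 2 - 2 * s ^ 2) + d ^ 4 * 6 - 4 * N * s * d ^ 2 * 3) * u ^ 2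
  let T : ℝ → ℝ := fun u =>
    (N * s - d ^ 2) * (1 + u ^ 2) + (2 * N ^ 2 - 2 * N * s + d ^ 2 * 2) * u
  have hD' : Continuous D' := by fun_prop
  have hlim : Tendsto (fun u => (T u + Real.sqrt (D' u)) /
      (2 * ((s + (N - s) * u) * ((N - s) + s * u)))) (𝓝[>] 0) (𝓝 (eigInf N s d)⁻¹) := by
    have hcont : ContinuousAt (fun u => (T u + Real.sqrt (D' u)) /
        (2 * ((s + (N - s) * u) * ((N - s) + s * u)))) 0 := by
      refine ContinuousAt.div (by fun_prop) (by fun_prop) ?_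
      have : 0 < 2 * (s * (N - s)) := by positivity
      simpa using this.ne'
    have h0 := hcont.tendsto.mono_left (nhdsWithin_le_nhds (s := Set.Ioi 0))
    convert h0 using 2
    have hT0 : T 0 = N * s - d ^ 2 := by simp [T]
    have hD0 : D' 0 = (N * s - d ^ 2) ^ 2 := by simp [D']
    rw [hT0, hD0, Real.sqrt_sq ha.le, eigInf]
    simp only [mul_zero, add_zero]
    field_simp
    ring
  refine hlim.congr' ?_
  have hpos : ∀ᶠ u in 𝓝[>] (0 : ℝ), 0 < D' u := by
    refine nhdsWithin_le_nhds (hD'.continuousAt.eventually_const_lt ?_)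
    have : 0 < (N * s - d ^ 2) ^ 2 := by positivity
    simpa [D'] using this
  filter_upwards [hpos, self_mem_nhdsWithin] with u hu hu0
  have hu0 : 0 < u := hu0
  have hdis : discr N s d 1 u⁻¹ = D' u / (u ^ 2) ^ 2 := by
    simp only [discr, D']
    field_simp
    ring
  have htr : traceTerm N s d 1 u⁻¹ = T u / u ^ 2 := by
    simp only [traceTerm, T]
    field_simp
    ring
  have hsq := traceTerm_sq_sub_discr N s d 1 u⁻¹
  rw [hdis, htr] at hsq
  have hprod : (T u - Real.sqrt (D' u)) * (T u + Real.sqrt (D' u))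
      = 4 * N ^ 2 * u * ((s + (N - s) * u) * ((N - s) + s * u)) := by
    have hroot := Real.sq_sqrt hu.le
    field_simp at hsq
    linear_combination hsq - hroot
  have hP : 0 < (s + (N - s) * u) * ((N - s) + s * u) := by positivity
  have hne : T u - Real.sqrt (D' u) ≠ 0 := by
    intro h0
    rw [h0, zero_mul] at hprod
    have : 0 < 4 * N ^ 2 * u * ((s + (N - s) * u) * ((N - s) + s * u)) := by positivity
    linarith
  have heig : 4 * eigSq N s d (hbar / 2) 1 u⁻¹
      = hbar ^ 2 * (T u - Real.sqrt (D' u)) / (2 * N ^ 2 * u) := by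
    rw [eigSq, hdis, htr, Real.sqrt_div hu.le, Real.sqrt_sq (by positivity)]
    field_simp
    ring
  rw [heig, div_eq_div_iff (by positivity)
    (div_ne_zero (mul_ne_zero (by positivity) hne) (by positivity))]
  field_simp
  linear_combination hprod

open Filter Topology in
lemma tendsto_logNegativity (hd : 0 ≤ d) (hds : d < s) (hsN : s < N) {hbar : ℝ}
    (hh : 0 < hbar) :
    Tendsto (fun u => (1 / 2) *
        Real.log (max (hbar ^ 2 / (4 * eigSq N s d (hbar / 2) 1 u⁻¹)) 1)) (𝓝[>] 0)
      (𝓝 ((1 / 2) * Real.log (1 + (s ^ 2 - d ^ 2) / (s * (N - s))))) := by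
  have hc0 := eigInf_pos hd hds hsN
  have h1 : 1 ≤ (eigInf N s d)⁻¹ := (one_le_inv₀ hc0).2 (eigInf_lt_one hd hds hsN).le
  have h := (tendsto_inv_eigSq hd hds hsN hh).max (tendsto_const_nhds (x := (1 : ℝ)))
  rw [max_eq_left h1] at h
  rw [one_add_div_eq_inv_eigInf hd hds hsN]
  exact (h.log (inv_pos.2 hc0).ne').const_mul _

end

end SymmetricGaussian

/-- Supremum of the logarithmic negativity between two blocks (of sizes summing to `n_s < N`
with difference `n_d`) of a permutation-symmetric `N`-mode Gaussian state: over all valid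
parameters (`ν_D ≥ ħ/2`, `ν_D γ ≥ ħ/2`, `r > 0`), the set of values
`(1/2) ln (max (ħ²/(4 f(ν_D,γ,r))) 1)` has least upper bound
`(1/2) ln (1 + (n_s² - n_d²)/(n_s (N - n_s)))`, and this supremum is not attained. -/
theorem sup_logNegativity (hbar : ℝ) (hhbar : 0 < hbar)
    (N ns nd : ℕ) (hns2 : 2 ≤ ns) (hnsN : ns < N) (hnd : nd < ns) :
    let Nr : ℝ := N
    let nsr : ℝ := ns
    let ndr : ℝ := nd
    let f : ℝ → ℝ → ℝ → ℝ := fun νD γ r =>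
      (νD ^ 2 / (2 * Nr ^ 2 * r)) *
        (((Nr * nsr - ndr ^ 2) * r ^ 2
            + (2 * Nr ^ 2 - 2 * Nr * nsr + ndr ^ 2 * (1 + γ ^ 2)) * r
            + (Nr * nsr - ndr ^ 2) * γ ^ 2)
          - Real.sqrt ((Nr * nsr - ndr ^ 2) ^ 2 * r ^ 4
            - 2 * ndr ^ 2 * (2 * Nr ^ 2 + ndr ^ 2 * (1 + γ ^ 2)
                - Nr * nsr * (3 + γ ^ 2)) * r ^ 3
            + (Nr ^ 2 * (4 * ndr ^ 2 * (1 + γ ^ 2) - 2 * nsr ^ 2 * γ ^ 2)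
                + ndr ^ 4 * (γ ^ 4 + 4 * γ ^ 2 + 1)
                - 4 * Nr * nsr * ndr ^ 2 * (1 + 2 * γ ^ 2)) * r ^ 2
            - 2 * ndr ^ 2 * (2 * Nr ^ 2 + ndr ^ 2 * (1 + γ ^ 2)
                - Nr * nsr * (3 + γ ^ 2)) * γ ^ 2 * r
            + (Nr * nsr - ndr ^ 2) ^ 2 * γ ^ 4))
    let S : Set ℝ := {x | ∃ νD γ r : ℝ,
      hbar / 2 ≤ νD ∧ hbar / 2 ≤ νD * γ ∧ 0 < r ∧
      x = (1 / 2) * Real.log (max (hbar ^ 2 / (4 * f νD γ r)) 1)}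
    let M : ℝ := (1 / 2) * Real.log (1 + (nsr ^ 2 - ndr ^ 2) / (nsr * (Nr - nsr)))
    IsLUB S M ∧ M ∉ S := by
  intro Nr nsr ndr f S M
  have hd : 0 ≤ ndr := Nat.cast_nonneg nd
  have hds : ndr < nsr := Nat.cast_lt.2 hnd
  have hsN : nsr < Nr := Nat.cast_lt.2 hnsN
  have hlt : ∀ x ∈ S, x < M := by
    rintro x ⟨νD, γ, r, hν, hνγ, hr, rfl⟩
    exact SymmetricGaussian.logNegativity_lt hd hds hsN hhbar hν hνγ hr
  refine ⟨⟨fun x hx => (hlt x hx).le, fun b hb => ?_⟩, fun hM => (hlt M hM).false⟩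
  refine le_of_tendsto (SymmetricGaussian.tendsto_logNegativity hd hds hsN hhbar) ?_
  filter_upwards [self_mem_nhdsWithin] with u hu
  exact hb ⟨hbar / 2, 1, u⁻¹, le_rfl, (mul_one _).ge, inv_pos.2 hu, rfl⟩
end

section
/- Let N and n_s be natural numbers with 2 ≤ n_s ≤ N, and let ν_D > 0, γ > 0 and r > 0 be reals with (r − 1)·(r − γ²) > 0. Then the function d ↦ f_d(ν_D, γ, r), obtained from the formula for f by replacing n_d with the real variable d, is strictly increasing on the interval [0, n_s). Consequently, with all other parameters fixed, the block negativity strictly decreases as the block-size difference n_d grows, unless it is already zero. -/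
/-- For `K > 0`, the smaller root `(a - √(a² - K)) / 2` of a quadratic with root sum `a` and root
product `K / 4` strictly decreases as `a` grows. -/
lemma sub_sqrt_sq_sub_lt {K a b : ℝ} (hK : 0 < K) (ha : 0 < a) (hab : a < b) (haK : K ≤ a ^ 2) :
    b - √(b ^ 2 - K) < a - √(a ^ 2 - K) := by
  have hsq : a ^ 2 < b ^ 2 := by gcongr
  have hlt : √(a ^ 2 - K) < √(b ^ 2 - K) := Real.sqrt_lt_sqrt (by linarith) (by linarith)
  have hsa := Real.sq_sqrt (show 0 ≤ a ^ 2 - K by linarith)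
  have hsb := Real.sq_sqrt (show 0 ≤ b ^ 2 - K by linarith)
  have hnn := Real.sqrt_nonneg (a ^ 2 - K)
  have hpos : 0 < a - √(a ^ 2 - K) := sub_pos.2 ((Real.sqrt_lt' ha).2 (by linarith))
  by_contra! hle
  have : (a - √(a ^ 2 - K)) * (a + √(a ^ 2 - K)) <
      (b - √(b ^ 2 - K)) * (b + √(b ^ 2 - K)) :=
    mul_lt_mul' hle (by linarith) (by linarith) (by linarith)
  nlinarith

/-- With all other parameters fixed and in the region `(r - 1)(r - γ²) > 0` (the only
region where entanglement can occur), the squared smaller symplectic eigenvalue `f_d`,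
viewed as a function of the real block-size difference `d`, is strictly increasing on
`[0, n_s)`.  Consequently the block negativity strictly decreases as the block-size
difference grows, unless it is already zero. -/
theorem f_strictMonoOn_blockDifference (N ns : ℕ) (hns2 : 2 ≤ ns) (hnsN : ns ≤ N)
    (νD γ r : ℝ) (hν : 0 < νD) (hγ : 0 < γ) (hr : 0 < r)
    (hreg : 0 < (r - 1) * (r - γ ^ 2)) :
    let Nr : ℝ := N
    let nsr : ℝ := ns
    StrictMonoOn (fun d : ℝ =>
      (νD ^ 2 / (2 * Nr ^ 2 * r)) *
        (((Nr * nsr - d ^ 2) * r ^ 2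
            + (2 * Nr ^ 2 - 2 * Nr * nsr + d ^ 2 * (1 + γ ^ 2)) * r
            + (Nr * nsr - d ^ 2) * γ ^ 2)
          - Real.sqrt ((Nr * nsr - d ^ 2) ^ 2 * r ^ 4
            - 2 * d ^ 2 * (2 * Nr ^ 2 + d ^ 2 * (1 + γ ^ 2)
                - Nr * nsr * (3 + γ ^ 2)) * r ^ 3
            + (Nr ^ 2 * (4 * d ^ 2 * (1 + γ ^ 2) - 2 * nsr ^ 2 * γ ^ 2)
                + d ^ 4 * (γ ^ 4 + 4 * γ ^ 2 + 1)
                - 4 * Nr * nsr * d ^ 2 * (1 + 2 * γ ^ 2)) * r ^ 2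
            - 2 * d ^ 2 * (2 * Nr ^ 2 + d ^ 2 * (1 + γ ^ 2)
                - Nr * nsr * (3 + γ ^ 2)) * γ ^ 2 * r
            + (Nr * nsr - d ^ 2) ^ 2 * γ ^ 4)))
      (Set.Ico (0 : ℝ) nsr) := by
  intro Nr nsr
  have hn : 0 < nsr := by
    have : (2 : ℝ) ≤ ns := by exact_mod_cast hns2
    exact lt_of_lt_of_le two_pos this
  have hM : 0 ≤ Nr - nsr := sub_nonneg.2 (Nat.cast_le.2 hnsN)
  have hN : 0 < Nr := by linarith
  clear_value Nr nsr
  -- `A = s₁ + s₂ + (ns² - d²) (r - 1) (r - γ²)` and `A² - B = 4 s₁ s₂` is independent of `d`.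
  obtain ⟨s₁, hs₁⟩ : ∃ s, s = (nsr * γ ^ 2 + (Nr - nsr) * r) * (nsr * r + (Nr - nsr)) := ⟨_, rfl⟩
  obtain ⟨s₂, hs₂⟩ : ∃ s, s = Nr ^ 2 * r := ⟨_, rfl⟩
  have hs₁pos : 0 < s₁ := by rw [hs₁]; positivity
  have hs₂pos : 0 < s₂ := by rw [hs₂]; positivity
  intro d hd e he hde
  obtain ⟨hd0, -⟩ := hd
  obtain ⟨he0, hen⟩ := he
  have hde2 : d ^ 2 < e ^ 2 := by gcongr
  have hen2 : e ^ 2 < nsr ^ 2 := by gcongr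
  have hp := mul_pos (sub_pos.2 hde2) hreg
  have hq := mul_pos (sub_pos.2 hen2) hreg
  have key := sub_sqrt_sq_sub_lt (K := 4 * s₁ * s₂)
    (a := s₁ + s₂ + (nsr ^ 2 - e ^ 2) * ((r - 1) * (r - γ ^ 2)))
    (b := s₁ + s₂ + (nsr ^ 2 - d ^ 2) * ((r - 1) * (r - γ ^ 2)))
    (by positivity) (by positivity) (by linarith)
    (by nlinarith [sq_nonneg (s₁ - s₂), mul_pos (add_pos hs₁pos hs₂pos) hq])
  refine mul_lt_mul_of_pos_left ?_ (by positivity)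
  subst hs₁ hs₂
  refine lt_of_eq_of_lt ?_ (lt_of_lt_of_eq key ?_) <;>
    refine congrArg₂ (· - ·) ?_ (congrArg Real.sqrt ?_) <;> ring
end
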